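/- For every mass μ on ℝ^7 there exist four pairwise orthogonal hyperplanes H_1, H_2, H_3, H_4 in ℝ^7 such that any three of the four hyperplanes equipartition μ; that is, for every choice of 1 ≤ i_1 < i_2 < i_3 ≤ 4, each of the eight regions H_{i_1}^± ∩ H_{i_2}^± ∩ H_{i_3}^± has μ-measure μ(ℝ^7)/8. (In particular Δ^⊥(1; 3/4) ≤ 7.) -/

import Mathlib

open MeasureTheory RealInnerProductSpace

noncomputable section

/-- The closed half-space determined by the hyperplane `{x | ⟪a, x⟫ = b}`:
`true` corresponds to `H⁺ = {x | ⟪a, x⟫ ≥ b}`, `false` to `H⁻ = {x | ⟪a, x⟫ ≤ b}`. -/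
def halfSpace {d : ℕ} (a : EuclideanSpace ℝ (Fin d)) (b : ℝ) (ε : Bool) :
    Set (EuclideanSpace ℝ (Fin d)) :=
  if ε then {x | b ≤ ⟪a, x⟫} else {x | ⟪a, x⟫ ≤ b}

/-- The region `⋂ i ∈ s, H i ^ (ε i)` determined by the hyperplanes indexed by `s`. -/
def region {d k : ℕ} (a : Fin k → EuclideanSpace ℝ (Fin d)) (b : Fin k → ℝ)
    (s : Finset (Fin k)) (ε : Fin k → Bool) : Set (EuclideanSpace ℝ (Fin d)) :=
  ⋂ i ∈ s, halfSpace (a i) (b i) (ε i)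

set_option linter.unusedSectionVars false
set_option linter.unusedVariables false

namespace BU
open MvPolynomial

variable {ι : Type} [Fintype ι] [DecidableEq ι] {n : ι → ℕ}

/-- Variables: block `i` has `n i + 1` variables. -/
abbrev Vr (n : ι → ℕ) := Σ i, Fin (n i + 1)

/-- Multi-degree weight of a variable. -/
def wt (n : ι → ℕ) : Vr n → (ι → ℕ) := fun s => Pi.single s.1 1

/-- The polynomial ring. -/
abbrev Sg (n : ι → ℕ) := MvPolynomial (Vr n) ℝ

/-- Multi-graded pieces. -/
abbrev Gr (n : ι → ℕ) (a : ι → ℕ) : Submodule ℝ (Sg n) := weightedHomogeneousSubmodule ℝ (wt n) a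

/-- Homogeneous component. -/
abbrev cmp (a : ι → ℕ) : Sg n →ₗ[ℝ] Sg n := weightedHomogeneousComponent (wt n) a

lemma cmp_mem (a : ι → ℕ) (p : Sg n) : cmp a p ∈ Gr n a :=
  weightedHomogeneousComponent_mem (wt n) p a

lemma cmp_of_mem {a b : ι → ℕ} {p : Sg n} (hp : p ∈ Gr n b) :
    cmp a p = if a = b then p else 0 :=
  weightedHomogeneousComponent_of_mem hp

lemma mul_mem_Gr {a b : ι → ℕ} {p q : Sg n} (hp : p ∈ Gr n a) (hq : q ∈ Gr n b) :
    p * q ∈ Gr n (a + b) :=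
  IsWeightedHomogeneous.mul hp hq

lemma X_mem_Gr (s : Vr n) : (X s : Sg n) ∈ Gr n (Pi.single s.1 1) :=
  isWeightedHomogeneous_X ℝ (wt n) s

lemma monomial_mem_Gr (m : Vr n →₀ ℕ) (r : ℝ) :
    (monomial m r : Sg n) ∈ Gr n (Finsupp.weight (wt n) m) :=
  isWeightedHomogeneous_monomial (wt n) m r rfl

lemma cmp_mul {a d : ι → ℕ} {f : Sg n} (hf : f ∈ Gr n d) (c : Sg n) :
    cmp (a + d) (c * f) = cmp a c * f := by
  induction c using MvPolynomial.induction_on' with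
  | monomial u r =>
    have h1 := monomial_mem_Gr (n := n) u r
    rw [cmp_of_mem h1, cmp_of_mem (mul_mem_Gr h1 hf)]
    by_cases h : a = Finsupp.weight (wt n) u
    · simp [h]
    · simp [h]
  | add p q hp hq => rw [add_mul, map_add, map_add, hp, hq, add_mul]

lemma cmp_mul_not_le {a d : ι → ℕ} {f : Sg n} (hf : f ∈ Gr n d) (c : Sg n) (h : ¬ d ≤ a) :
    cmp a (c * f) = 0 := by
  induction c using MvPolynomial.induction_on' with
  | monomial u r =>
    have h1 := monomial_mem_Gr (n := n) u r
    rw [cmp_of_mem (mul_mem_Gr h1 hf), if_neg]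
    rintro rfl
    exact h le_add_self
  | add p q hp hq => rw [add_mul, map_add, hp, hq, add_zero]

/-- Homogeneous ideals. -/
def IsHom (I : Ideal (Sg n)) : Prop := ∀ p ∈ I, ∀ a, cmp a p ∈ I

lemma isHom_bot : IsHom (⊥ : Ideal (Sg n)) := by
  intro p hp a
  rw [Ideal.mem_bot] at hp ⊢
  rw [hp, map_zero]

lemma isHom_sup_span {I : Ideal (Sg n)} (hI : IsHom I) {f : Sg n} {d : ι → ℕ} (hf : f ∈ Gr n d) :
    IsHom (I ⊔ Ideal.span {f}) := by
  intro p hp a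
  obtain ⟨x, hx, y, hy, rfl⟩ := Submodule.mem_sup.1 hp
  obtain ⟨c, rfl⟩ := Ideal.mem_span_singleton'.1 hy
  rw [map_add]
  refine Ideal.add_mem _ (Ideal.mem_sup_left (hI x hx a)) (Ideal.mem_sup_right ?_)
  by_cases h : d ≤ a
  · obtain ⟨e, rfl⟩ := exists_add_of_le h
    rw [add_comm d e, cmp_mul hf]
    exact Ideal.mul_mem_left _ _ (Ideal.subset_span rfl)
  · rw [cmp_mul_not_le hf c h]; exact Ideal.zero_mem _

lemma aeval_scale {R : Type*} [CommRing R] [Algebra ℝ R] {e : ι → ℕ} {F : Sg n} (hF : F ∈ Gr n e)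
    (y : Vr n → R) (r : ι → R) :
    aeval (fun s : Vr n => r s.1 * y s) F = (∏ i, r i ^ e i) * aeval y F := by
  have key : ∀ m : Vr n →₀ ℕ, (∏ s, (r s.1 * y s) ^ m s) =
      (∏ i, r i ^ (Finsupp.weight (wt n) m i)) * ∏ s, y s ^ m s := by
    intro m
    simp_rw [mul_pow, Finset.prod_mul_distrib]
    congr 1
    rw [← Finset.univ_sigma_univ, Finset.prod_sigma]
    refine Finset.prod_congr rfl fun i _ => ?_
    change ∏ s : Fin (n i + 1), r i ^ m ⟨i, s⟩ = _
    rw [Finset.prod_pow_eq_pow_sum]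
    congr 1
    rw [Finsupp.weight_apply, Finsupp.sum_fintype _ _ (by simp), Finset.sum_apply,
      ← Finset.univ_sigma_univ, Finset.sum_sigma, Finset.sum_eq_single i]
    · simp [wt]
    · intro b _ hb
      refine Finset.sum_eq_zero fun x _ => ?_
      simp [wt, hb.symm]
    · simp
  rw [aeval_def, aeval_def, eval₂_eq', eval₂_eq', Finset.mul_sum]
  refine Finset.sum_congr rfl fun m hm => ?_
  rw [key, hF (mem_support_iff.1 hm)]
  ring

/-- Irrelevant ideal of a block. -/
def blk (n : ι → ℕ) (i : ι) : Ideal (Sg n) := Ideal.span (Set.range fun j : Fin (n i + 1) => X ⟨i, j⟩)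

lemma Gr_le_pow {e : ι → ℕ} {N : ℕ} (he : ∀ i, N ≤ e i) {p : Sg n} (hp : p ∈ Gr n e) :
    p ∈ (∏ i, blk n i) ^ N := by
  rw [p.as_sum]
  refine Ideal.sum_mem _ fun m hm => ?_
  have hw := hp (mem_support_iff.1 hm)
  rw [monomial_eq, Finsupp.prod_fintype _ _ (by simp), ← Finset.univ_sigma_univ, Finset.prod_sigma]
  refine Ideal.mul_mem_left _ _ ?_
  rw [← Finset.prod_pow]
  refine Ideal.prod_mem_prod fun i _ => ?_
  have h1 : (∏ j, (X ⟨i, j⟩ : Sg n) ^ m ⟨i, j⟩) ∈ ∏ j : Fin (n i + 1), blk n i ^ m ⟨i, j⟩ :=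
    Ideal.prod_mem_prod fun j _ => Ideal.pow_mem_pow (Ideal.subset_span (Set.mem_range_self (f := fun j : Fin (n i + 1) => (X ⟨i, j⟩ : Sg n)) j)) _
  rw [Finset.prod_pow_eq_pow_sum] at h1
  refine Ideal.pow_le_pow_right ?_ h1
  have : (Finsupp.weight (wt n) m) i = ∑ j, m ⟨i, j⟩ := by
    rw [Finsupp.weight_apply, Finsupp.sum_fintype _ _ (by simp), Finset.sum_apply,
      ← Finset.univ_sigma_univ, Finset.sum_sigma, Finset.sum_eq_single i]
    · simp [wt]
    · intro b _ hb
      refine Finset.sum_eq_zero fun x _ => ?_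
      simp [wt, hb.symm]
    · simp
  rw [← this, hw]
  exact he i

/-- Relevant primes: contain no block of variables. -/
def Rel (p : Ideal (Sg n)) : Prop := ∀ i, ∃ j, (X ⟨i, j⟩ : Sg n) ∉ p

/-- `f` avoids all the relevant associated primes of `S/I`. -/
def Avoids (I : Ideal (Sg n)) (f : Sg n) : Prop :=
  ∀ p ∈ associatedPrimes (Sg n) (Sg n ⧸ I), Rel p → f ∉ p

lemma exists_pow_le {I : Ideal (Sg n)} {f : Sg n} (hf : Avoids I f) :
    ∃ N : ℕ, ∀ b ∈ (∏ i, blk n i) ^ N, ∀ g, g * f ∈ I → b * g ∈ I := by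
  let K : Submodule (Sg n) (Sg n ⧸ I) := LinearMap.ker (LinearMap.lsmul (Sg n) (Sg n ⧸ I) f)
  have h1 : (∏ i, blk n i) ≤ (Module.annihilator (Sg n) K).radical := by
    rw [Ideal.radical_eq_sInf]
    refine le_sInf fun q hq => ?_
    obtain ⟨hq1, hq2⟩ := hq
    obtain ⟨p, hp, hpq⟩ := Ideal.exists_minimalPrimes_le hq1
    refine le_trans ?_ hpq
    have hpa := Module.associatedPrimes.minimalPrimes_annihilator_subset_associatedPrimes _ _ hp
    have hpa' : p ∈ associatedPrimes (Sg n) (Sg n ⧸ I) :=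
      associatedPrimes.subset_of_injective (f := K.subtype) K.subtype_injective hpa
    have hfp : f ∈ p := by
      refine hp.1.2 ?_
      rw [Module.mem_annihilator]
      rintro ⟨x, hx⟩
      exact Subtype.ext hx
    have hrel : ¬ Rel p := fun h => hf p hpa' h hfp
    unfold Rel at hrel
    push Not at hrel
    obtain ⟨i, hi⟩ := hrel
    refine le_trans (Ideal.prod_le_inf.trans (Finset.inf_le (Finset.mem_univ i))) ?_
    rw [blk, Ideal.span_le]
    rintro _ ⟨j, rfl⟩
    exact hi j
  obtain ⟨N, hN⟩ := Ideal.exists_pow_le_of_le_radical_of_fg h1 (IsNoetherian.noetherian _)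
  refine ⟨N, fun b hb g hg => ?_⟩
  have hb' := hN hb
  rw [Module.mem_annihilator] at hb'
  have hgK : Ideal.Quotient.mk I g ∈ K := by
    rw [LinearMap.mem_ker, LinearMap.lsmul_apply]
    change Ideal.Quotient.mk I (f * g) = 0
    rw [Ideal.Quotient.eq_zero_iff_mem, mul_comm]
    exact hg
  have := congrArg Subtype.val (hb' ⟨_, hgK⟩)
  simp only [Submodule.coe_smul, ZeroMemClass.coe_zero] at this
  change Ideal.Quotient.mk I (b * g) = 0 at this
  rwa [Ideal.Quotient.eq_zero_iff_mem] at this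

/-- Eventually, multiplication by an avoiding form is injective. -/
lemma eventually_inj {I : Ideal (Sg n)} (hI : IsHom I) {f : Sg n} {d : ι → ℕ} (hfd : f ∈ Gr n d)
    (hf : Avoids I f) :
    ∃ A : ℕ, ∀ a : ι → ℕ, (∀ i, A ≤ a i) → ∀ g ∈ Gr n a, g * f ∈ I → g ∈ I := by
  obtain ⟨N, hN⟩ := exists_pow_le hf
  let L : Ideal (Sg n) :=
    { carrier := {g | g * f ∈ I}
      add_mem' := fun {x y} hx hy => by
        simp only [Set.mem_ofPred_eq, add_mul] at *; exact I.add_mem hx hy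
      zero_mem' := by simp
      smul_mem' := fun c x hx => by
        simp only [Set.mem_ofPred_eq, smul_eq_mul, mul_assoc] at *; exact I.mul_mem_left _ hx }
  have hL : ∀ g, g ∈ L ↔ g * f ∈ I := fun g => Iff.rfl
  have hLhom : IsHom L := by
    intro p hp a
    rw [hL, ← cmp_mul hfd]
    exact hI _ hp _
  obtain ⟨T, hT⟩ : L.FG := IsNoetherian.noetherian _
  -- bound for each element
  have bound : ∀ t ∈ L, ∃ A : ℕ, ∀ a : ι → ℕ, (∀ i, A ≤ a i) → ∀ c : Sg n, cmp a (c * t) ∈ I := by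
    intro t ht
    refine ⟨N + t.support.sup (fun m => Finset.univ.sup (Finsupp.weight (wt n) m)),
      fun a ha c => ?_⟩
    have hsum : t = ∑ m ∈ t.support.image (Finsupp.weight (wt n)), cmp m t := by
      ext u
      rw [coeff_sum]
      by_cases hu : u ∈ t.support
      · rw [Finset.sum_eq_single (Finsupp.weight (wt n) u)]
        · rw [coeff_weightedHomogeneousComponent, if_pos rfl]
        · intro b _ hb
          rw [coeff_weightedHomogeneousComponent, if_neg hb.symm]
        · intro h
          exact absurd (Finset.mem_image_of_mem _ hu) h
      · rw [Finset.sum_eq_zero, notMem_support_iff.1 hu]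
        intro b _
        rw [coeff_weightedHomogeneousComponent, notMem_support_iff.1 hu, ite_self]
    rw [hsum, Finset.mul_sum, map_sum]
    refine Ideal.sum_mem _ fun b hb => ?_
    obtain ⟨m, hm, rfl⟩ := Finset.mem_image.1 hb
    have hle : ∀ i, Finsupp.weight (wt n) m i ≤
        t.support.sup (fun m => Finset.univ.sup (Finsupp.weight (wt n) m)) := by
      intro i
      refine le_trans ?_ (Finset.le_sup (f := fun m => Finset.univ.sup (Finsupp.weight (wt n) m)) hm)
      exact Finset.le_sup (f := (Finsupp.weight (wt n) m)) (Finset.mem_univ i)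
    have hle' : Finsupp.weight (wt n) m ≤ a := fun i =>
      (hle i).trans ((Nat.le_add_left _ _).trans (ha i))
    obtain ⟨e, rfl⟩ := exists_add_of_le hle'
    rw [add_comm _ e, cmp_mul (cmp_mem _ t)]
    refine hN _ (Gr_le_pow (fun i => ?_) (cmp_mem _ _)) _ (hLhom t ht _)
    have h1 := hle i
    have h2 := ha i
    simp only [Pi.add_apply] at h2
    omega
  have bound' : ∃ A : ℕ, ∀ t ∈ T, ∀ a : ι → ℕ, (∀ i, A ≤ a i) → ∀ c : Sg n, cmp a (c * t) ∈ I := by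
    have : ∀ t, ∃ A : ℕ, t ∈ T → ∀ a : ι → ℕ, (∀ i, A ≤ a i) → ∀ c : Sg n, cmp a (c * t) ∈ I := by
      intro t
      by_cases h : t ∈ T
      · obtain ⟨A, hA⟩ := bound t (hT ▸ Ideal.subset_span h)
        exact ⟨A, fun _ => hA⟩
      · exact ⟨0, fun h' => absurd h' h⟩
    choose A hA using this
    refine ⟨T.sup A, fun t ht a ha c => hA t ht a (fun i => (Finset.le_sup ht).trans (ha i)) c⟩
  obtain ⟨A, hA⟩ := bound'
  refine ⟨A, fun a ha g hg hgf => ?_⟩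
  have hgL : g ∈ Ideal.span (T : Set (Sg n)) := by rw [show Ideal.span (T : Set (Sg n)) = L from hT]; exact hgf
  obtain ⟨c, hc⟩ := Submodule.mem_span_finset.1 hgL
  have : g = cmp a g := by rw [cmp_of_mem hg, if_pos rfl]
  rw [this, ← hc.2, map_sum]
  exact Ideal.sum_mem _ fun t ht => hA t ht a ha _

lemma exists_avoid (I : Ideal (Sg n)) (d : ι → ℕ) : ∃ g ∈ Gr n d, Avoids I g := by
  let P : Set (Ideal (Sg n)) := {p ∈ associatedPrimes (Sg n) (Sg n ⧸ I) | Rel p}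
  have hP : P.Finite := (associatedPrimes.finite (Sg n) (Sg n ⧸ I)).subset fun p hp => hp.1
  have hfin : Finite P := hP
  let U : P → Submodule ℝ (Gr n d) := fun p => (p.1.restrictScalars ℝ).comap (Gr n d).subtype
  have hU : ∀ p, U p ≠ ⊤ := by
    rintro ⟨p, hp, hrel⟩ htop
    choose j hj using id hrel
    have hpp : p.IsPrime := hp.isPrime
    have hmem : (∏ i, (X ⟨i, j i⟩ : Sg n) ^ d i) ∈ Gr n d := by
      have := IsWeightedHomogeneous.prod Finset.univ (fun i => (X ⟨i, j i⟩ : Sg n) ^ d i)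
        (fun i => d i • (Pi.single i 1 : ι → ℕ)) (w := wt n)
        (fun i _ => (isWeightedHomogeneous_X ℝ (wt n) ⟨i, j i⟩).pow (d i))
      have e : ∑ i, d i • (Pi.single i 1 : ι → ℕ) = d := by
        ext i
        simp [Finset.sum_apply, Pi.single_apply]
      rw [e] at this
      exact this
    have : (⟨_, hmem⟩ : Gr n d) ∈ U ⟨p, hp, hrel⟩ := htop ▸ Submodule.mem_top
    have h2 : (∏ i, (X ⟨i, j i⟩ : Sg n) ^ d i) ∈ p := this
    obtain ⟨i, _, hi⟩ := (hpp.prod_mem_iff).1 h2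
    exact hj i (hpp.mem_of_pow_mem _ hi)
  have hne : ⋃ p, (U p : Set (Gr n d)) ≠ Set.univ := by
    intro h
    obtain ⟨p, hp⟩ := Subspace.exists_eq_top_of_iUnion_eq_univ h
    exact hU p hp
  obtain ⟨g, hg⟩ := (Set.ne_univ_iff_exists_notMem _).1 hne
  refine ⟨g.1, g.2, fun p hp hrel hgp => hg ?_⟩
  exact Set.mem_iUnion.2 ⟨⟨p, hp, hrel⟩, hgp⟩

lemma exists_avoid_near (I : Ideal (Sg n)) {d : ι → ℕ} {f : Sg n} (hf : f ∈ Gr n d) :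
    ∃ g ∈ Gr n d, ∀ ε > (0 : ℝ), ∃ t : ℝ, 0 < t ∧ t < ε ∧ Avoids I (f + t • g) := by
  obtain ⟨g, hg, hgI⟩ := exists_avoid I d
  refine ⟨g, hg, fun ε hε => ?_⟩
  have hP := associatedPrimes.finite (Sg n) (Sg n ⧸ I)
  let bad : Set ℝ := ⋃ p ∈ associatedPrimes (Sg n) (Sg n ⧸ I), {t : ℝ | Rel p ∧ f + t • g ∈ p}
  have hbad : bad.Finite := by
    refine hP.biUnion fun p hp => Set.Subsingleton.finite ?_
    rintro t ⟨hr, ht⟩ u ⟨_, hu⟩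
    by_contra hne
    have h1 : (t - u) • g ∈ p := by
      have := p.sub_mem ht hu
      convert this using 1
      rw [sub_smul]; ring
    have h2 : (t - u)⁻¹ • ((t - u) • g) ∈ p := by
      rw [Algebra.smul_def]; exact p.mul_mem_left _ h1
    rw [inv_smul_smul₀ (sub_ne_zero.2 hne)] at h2
    exact hgI p hp hr h2
  obtain ⟨t, ht, ht'⟩ := (Set.Ioo_infinite hε).exists_notMem_finite hbad
  refine ⟨t, ht.1, ht.2, fun p hp hr h => ht' ?_⟩
  exact Set.mem_biUnion hp ⟨hr, h⟩

end BU

namespace BU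
open MvPolynomial

variable {ι : Type} [Fintype ι] [DecidableEq ι] {n : ι → ℕ}

lemma weight_apply' (m : Vr n →₀ ℕ) (i : ι) : (Finsupp.weight (wt n) m) i = ∑ j, m ⟨i, j⟩ := by
  rw [Finsupp.weight_apply, Finsupp.sum_fintype _ _ (by simp), Finset.sum_apply,
    ← Finset.univ_sigma_univ, Finset.sum_sigma, Finset.sum_eq_single i]
  · simp [wt]
  · intro b _ hb
    refine Finset.sum_eq_zero fun x _ => ?_
    simp [wt, hb.symm]
  · simp

lemma card_simplex (k a : ℕ) : Nat.card {v : Fin (k + 1) → ℕ // ∑ j, v j = a} = (a + k).choose k := by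
  have e : {v : Fin (k + 1) → ℕ // ∑ j, v j = a} ≃
      ((Finset.univ : Finset (Fin (k + 1))).finsuppAntidiag a : Finset _) :=
    (Finsupp.equivFunOnFinite.symm).subtypeEquiv (by
      intro v
      simp [Finset.mem_finsuppAntidiag])
  rw [Nat.card_congr e, Nat.card_eq_fintype_card, Fintype.card_coe,
    Finset.card_finsuppAntidiag_nat_eq_multichoose, Nat.multichoose_eq, Finset.card_univ,
    Fintype.card_fin, show k + 1 + a - 1 = a + k by omega]
  exact Nat.choose_symm_add

lemma card_monos (a : ι → ℕ) :
    Nat.card {m : Vr n →₀ ℕ | Finsupp.weight (wt n) m = a} = ∏ i, (a i + n i).choose (n i) := by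
  have e : {m : Vr n →₀ ℕ | Finsupp.weight (wt n) m = a} ≃
      {v : ∀ i, Fin (n i + 1) → ℕ // ∀ i, ∑ j, v i j = a i} :=
    (Finsupp.equivFunOnFinite.trans (Equiv.piCurry (fun (i : ι) (_ : Fin (n i + 1)) => ℕ))).subtypeEquiv (by
      intro m
      change Finsupp.weight (wt n) m = a ↔ _
      rw [funext_iff]
      simp_rw [weight_apply']
      rfl)
  rw [Nat.card_congr (e.trans (Equiv.subtypePiEquivPi (β := fun i => Fin (n i + 1) → ℕ) (p := fun {i} v => ∑ j, v j = a i))), Nat.card_pi]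
  exact Finset.prod_congr rfl fun i _ => card_simplex _ _

lemma finite_monos (a : ι → ℕ) : Finite {m : Vr n →₀ ℕ | Finsupp.weight (wt n) m = a} := by
  apply Nat.finite_of_card_ne_zero
  rw [card_monos]
  exact Finset.prod_ne_zero_iff.2 fun i _ => (Nat.choose_pos (Nat.le_add_left _ _)).ne'

/-- Coordinates on a graded piece. -/
def GrEquiv (n : ι → ℕ) (a : ι → ℕ) :
    Gr n a ≃ₗ[ℝ] ({m : Vr n →₀ ℕ | Finsupp.weight (wt n) m = a} →₀ ℝ) :=
  (LinearEquiv.ofEq _ _ (weightedHomogeneousSubmodule_eq_finsupp_supported ℝ (wt n) a)).trans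
    (AddMonoidAlgebra.supportedEquivFinsupp _)

instance (a : ι → ℕ) : FiniteDimensional ℝ (Gr n a) := by
  have := finite_monos (n := n) a
  exact Module.Finite.equiv (GrEquiv n a).symm

lemma finrank_Gr (a : ι → ℕ) : Module.finrank ℝ (Gr n a) = ∏ i, (a i + n i).choose (n i) := by
  have := finite_monos (n := n) a
  have := Fintype.ofFinite {m : Vr n →₀ ℕ | Finsupp.weight (wt n) m = a}
  rw [(GrEquiv n a).finrank_eq, Module.finrank_finsupp_self, ← Nat.card_eq_fintype_card, card_monos]

/-- Graded pieces of the quotient. -/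
def Vq (I : Ideal (Sg n)) (a : ι → ℕ) : Submodule ℝ (Sg n ⧸ I) :=
  (Gr n a).map (Ideal.Quotient.mkₐ ℝ I).toLinearMap

instance (I : Ideal (Sg n)) (a : ι → ℕ) : FiniteDimensional ℝ (Vq I a) := by
  unfold Vq; infer_instance

/-- Hilbert function. -/
def hilb (I : Ideal (Sg n)) (a : ι → ℕ) : ℕ := Module.finrank ℝ (Vq I a)

lemma mem_Vq {I : Ideal (Sg n)} {a : ι → ℕ} {x : Sg n ⧸ I} :
    x ∈ Vq I a ↔ ∃ g ∈ Gr n a, Ideal.Quotient.mk I g = x := Iff.rfl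

lemma hilb_bot (a : ι → ℕ) : hilb (⊥ : Ideal (Sg n)) a = ∏ i, (a i + n i).choose (n i) := by
  rw [← finrank_Gr, hilb, Vq]
  have hinj : Function.Injective (Ideal.Quotient.mkₐ ℝ (⊥ : Ideal (Sg n))).toLinearMap := by
    intro x y hxy
    have : Ideal.Quotient.mk (⊥ : Ideal (Sg n)) x = Ideal.Quotient.mk ⊥ y := hxy
    rw [Ideal.Quotient.eq, Ideal.mem_bot, sub_eq_zero] at this
    exact this
  exact (Submodule.equivMapOfInjective _ hinj _).finrank_eq.symm

/-- Multiplication by a form on graded pieces. -/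
def mulV (I : Ideal (Sg n)) {d : ι → ℕ} {f : Sg n} (hf : f ∈ Gr n d) (a : ι → ℕ) :
    Vq I a →ₗ[ℝ] Vq I (a + d) :=
  LinearMap.codRestrict _ ((LinearMap.mulRight ℝ (Ideal.Quotient.mk I f)).domRestrict (Vq I a)) (by
    rintro ⟨x, hx⟩
    obtain ⟨g, hg, rfl⟩ := mem_Vq.1 hx
    exact mem_Vq.2 ⟨g * f, mul_mem_Gr hg hf, by simp⟩)

lemma mulV_coe (I : Ideal (Sg n)) {d : ι → ℕ} {f : Sg n} (hf : f ∈ Gr n d) (a : ι → ℕ) (x : Vq I a) :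
    (mulV I hf a x : Sg n ⧸ I) = x * Ideal.Quotient.mk I f := rfl

lemma mulV_inj {I : Ideal (Sg n)} {d : ι → ℕ} {f : Sg n} (hf : f ∈ Gr n d) {a : ι → ℕ}
    (h : ∀ g ∈ Gr n a, g * f ∈ I → g ∈ I) : Function.Injective (mulV I hf a) := by
  rw [← LinearMap.ker_eq_bot, LinearMap.ker_eq_bot']
  rintro ⟨x, hx⟩ h0
  obtain ⟨g, hg, rfl⟩ := mem_Vq.1 hx
  have h1 := congrArg Subtype.val h0
  rw [mulV_coe] at h1
  simp only [ZeroMemClass.coe_zero] at h1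
  rw [← map_mul, Ideal.Quotient.eq_zero_iff_mem] at h1
  exact Subtype.ext (Ideal.Quotient.eq_zero_iff_mem.2 (h g hg h1))

lemma hilb_step {I : Ideal (Sg n)} (hI : IsHom I) {f : Sg n} {d : ι → ℕ} (hfd : f ∈ Gr n d)
    {a : ι → ℕ} (hinj : ∀ g ∈ Gr n a, g * f ∈ I → g ∈ I) :
    hilb I (a + d) = hilb (I ⊔ Ideal.span {f}) (a + d) + hilb I a := by
  have hle : I ≤ I ⊔ Ideal.span {f} := le_sup_left
  let φ : (Sg n ⧸ I) →ₗ[ℝ] (Sg n ⧸ (I ⊔ Ideal.span {f})) := (Ideal.Quotient.factorₐ ℝ hle).toLinearMap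
  have hφ : ∀ g, φ (Ideal.Quotient.mk I g) = Ideal.Quotient.mk _ g := fun g => rfl
  let φ' := φ.domRestrict (Vq I (a + d))
  have hr : LinearMap.range φ' = Vq (I ⊔ Ideal.span {f}) (a + d) := by
    ext y
    constructor
    · rintro ⟨⟨x, hx⟩, rfl⟩
      obtain ⟨g, hg, rfl⟩ := mem_Vq.1 hx
      exact mem_Vq.2 ⟨g, hg, rfl⟩
    · intro hy
      obtain ⟨g, hg, rfl⟩ := mem_Vq.1 hy
      exact ⟨⟨_, mem_Vq.2 ⟨g, hg, rfl⟩⟩, rfl⟩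
  have hk : LinearMap.ker φ' = LinearMap.range (mulV I hfd a) := by
    ext ⟨x, hx⟩
    constructor
    · intro h0
      obtain ⟨g, hg, rfl⟩ := mem_Vq.1 hx
      have h1 : Ideal.Quotient.mk (I ⊔ Ideal.span {f}) g = 0 := h0
      rw [Ideal.Quotient.eq_zero_iff_mem] at h1
      obtain ⟨u, hu, y, hy, huy⟩ := Submodule.mem_sup.1 h1
      obtain ⟨c, rfl⟩ := Ideal.mem_span_singleton'.1 hy
      have h2 : g = cmp (a + d) u + cmp a c * f := by
        rw [← cmp_mul hfd, ← map_add, huy, cmp_of_mem hg, if_pos rfl]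
      refine ⟨⟨_, mem_Vq.2 ⟨cmp a c, cmp_mem _ _, rfl⟩⟩, Subtype.ext ?_⟩
      rw [mulV_coe]
      change Ideal.Quotient.mk I (cmp a c) * _ = Ideal.Quotient.mk I g
      rw [← map_mul, Ideal.Quotient.eq]
      have : cmp a c * f - g = - cmp (a + d) u := by rw [h2]; ring
      rw [this]
      exact I.neg_mem (hI u hu _)
    · rintro ⟨⟨y, hy⟩, hyx⟩
      obtain ⟨g, hg, rfl⟩ := mem_Vq.1 hy
      have h1 : Ideal.Quotient.mk I g * Ideal.Quotient.mk I f = x := congrArg Subtype.val hyx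
      change φ x = 0
      rw [← h1]
      change Ideal.Quotient.mk (I ⊔ Ideal.span {f}) (g * f) = 0
      rw [Ideal.Quotient.eq_zero_iff_mem]
      exact Ideal.mem_sup_right (Ideal.mul_mem_left _ _ (Ideal.subset_span rfl))
  have h := LinearMap.finrank_range_add_finrank_ker φ'
  rw [hr, hk, LinearMap.finrank_range_of_inj (mulV_inj hfd hinj)] at h
  exact h.symm

lemma odd_root (k : ℕ) : ∀ p : Polynomial ℝ, p.natDegree = k → Odd k → ∃ c, p.IsRoot c := by
  induction k using Nat.strong_induction_on with
  | _ k ih =>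
  intro p hp hk
  have hp0 : p ≠ 0 := by
    rintro rfl
    rw [Polynomial.natDegree_zero] at hp
    exact hk.pos.ne hp
  have hu : ¬ IsUnit p := fun h => by
    have := Polynomial.natDegree_eq_zero_of_isUnit h
    have := hk.pos
    omega
  obtain ⟨q, hq, r, rfl⟩ := WfDvdMonoid.exists_irreducible_factor hu hp0
  have hq2 := hq.natDegree_le_two
  have hq0 : 0 < q.natDegree := hq.natDegree_pos
  rw [Polynomial.natDegree_mul (left_ne_zero_of_mul hp0) (right_ne_zero_of_mul hp0)] at hp
  by_cases h1 : q.natDegree = 1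
  · obtain ⟨c, hc⟩ := Polynomial.exists_root_of_degree_eq_one
      ((Polynomial.degree_eq_iff_natDegree_eq hq.ne_zero).2 h1)
    exact ⟨c, by simp [Polynomial.IsRoot, hc.eq_zero]⟩
  · have h2 : q.natDegree = 2 := by omega
    obtain ⟨c, hc⟩ := ih r.natDegree (by omega) r rfl (by
      rw [← hp, h2, add_comm] at hk
      exact (Nat.odd_add.1 hk).2 even_two)
    exact ⟨c, by simp [Polynomial.IsRoot, hc.eq_zero]⟩

/-- Common eigenvectors of commuting families in odd dimension. -/
lemma common_eigenvector {T : Type*} (k : ℕ) : ∀ (W : Type) [AddCommGroup W] [Module ℝ W]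
    [FiniteDimensional ℝ W] (M : T → W →ₗ[ℝ] W), (∀ s t w, M s (M t w) = M t (M s w)) →
    Module.finrank ℝ W = k → Odd k → ∃ v : W, v ≠ 0 ∧ ∃ l : T → ℝ, ∀ s, M s v = l s • v := by
  induction k using Nat.strong_induction_on with
  | _ k ih =>
  intro W _ _ _ M hM hk hodd
  by_cases hsc : ∀ s, ∃ c : ℝ, ∀ v, M s v = c • v
  · choose l hl using hsc
    have : 0 < Module.finrank ℝ W := by rw [hk]; exact hodd.pos
    have := Module.finrank_pos_iff.1 this
    obtain ⟨v, hv⟩ := exists_ne (0 : W)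
    exact ⟨v, hv, l, fun s => hl s v⟩
  push Not at hsc
  obtain ⟨s, hs⟩ := hsc
  have hdeg : Odd (M s).charpoly.natDegree := by rw [LinearMap.charpoly_natDegree, hk]; exact hodd
  obtain ⟨c, hc⟩ := odd_root _ _ rfl hdeg
  let D : W →ₗ[ℝ] W := M s - c • LinearMap.id
  have hD : ∀ w, D w = M s w - c • w := fun w => rfl
  have hker : LinearMap.ker D ≠ ⊥ := by
    have := (Module.End.hasEigenvalue_iff_isRoot_charpoly (M s) c).2 hc
    obtain ⟨v, hv⟩ := this.exists_hasEigenvector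
    intro hbot
    have : v ∈ LinearMap.ker D := by
      rw [LinearMap.mem_ker, hD, hv.apply_eq_smul, sub_self]
    rw [hbot] at this
    exact hv.2 this
  have hDc : ∀ t w, D (M t w) = M t (D w) := by
    intro t w; rw [hD, hD, map_sub, map_smul, hM]
  have hrn := LinearMap.finrank_range_add_finrank_ker D
  have hkpos : 0 < Module.finrank ℝ (LinearMap.ker D) := by
    rw [Nat.pos_iff_ne_zero]
    exact fun h => hker (Submodule.finrank_eq_zero.1 h)
  have hrpos : 0 < Module.finrank ℝ (LinearMap.range D) := by
    rw [Nat.pos_iff_ne_zero]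
    intro h
    have h0 := Submodule.finrank_eq_zero.1 h
    rw [LinearMap.range_eq_bot] at h0
    obtain ⟨v, hv⟩ := hs c
    apply hv
    have := LinearMap.congr_fun h0 v
    rw [hD] at this
    exact sub_eq_zero.1 this
  -- invariant subspaces
  have fin : ∀ U : Submodule ℝ W, (∀ t, ∀ u ∈ U, M t u ∈ U) → Module.finrank ℝ U < k →
      Odd (Module.finrank ℝ U) → ∃ v : W, v ≠ 0 ∧ ∃ l : T → ℝ, ∀ s, M s v = l s • v := by
    intro U hU hlt ho
    obtain ⟨v, hv, l, hl⟩ := ih _ hlt U (fun t => (M t).restrict (hU t))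
      (fun s t w => Subtype.ext (hM s t w)) rfl ho
    exact ⟨v, fun h => hv (Subtype.ext h), l, fun s => congrArg Subtype.val (hl s)⟩
  rcases Nat.even_or_odd (Module.finrank ℝ (LinearMap.ker D)) with he | ho
  · refine fin (LinearMap.range D) ?_ (by omega) ?_
    · rintro t _ ⟨w, rfl⟩
      exact ⟨M t w, hDc t w⟩
    · rw [← hk, ← hrn] at hodd
      exact (Nat.odd_add.1 hodd).2 he
  · refine fin (LinearMap.ker D) ?_ (by omega) ho
    intro t u hu
    rw [LinearMap.mem_ker] at hu ⊢
    rw [hDc, hu, map_zero]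

end BU

namespace BU
open MvPolynomial

variable {ι : Type} [Fintype ι] [DecidableEq ι] {n : ι → ℕ}

lemma mul_mem_Vq {I : Ideal (Sg n)} {a d : ι → ℕ} {x : Sg n ⧸ I} {f : Sg n} (hx : x ∈ Vq I a)
    (hf : f ∈ Gr n d) : x * Ideal.Quotient.mk I f ∈ Vq I (a + d) := (mulV I hf a ⟨x, hx⟩).2

lemma real_point {I : Ideal (Sg n)} (hI : IsHom I) (A c : ℕ) (hc : Odd c)
    (hH : ∀ a : ι → ℕ, (∀ i, A ≤ a i) → hilb I a = c) :
    ∃ z : Vr n → ℝ, (∀ i, ∃ j, z ⟨i, j⟩ ≠ 0) ∧ ∀ e, ∀ F ∈ Gr n e, F ∈ I → eval z F = 0 := by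
  have h1 : ∀ i : ι, ∃ g ∈ Gr n (Pi.single i 1), Avoids I g := fun i => exists_avoid I _
  choose l hl hlI using h1
  have h2 := fun i => eventually_inj hI (hl i) (hlI i)
  choose A1 hA1 using h2
  set B : ℕ := A + Finset.univ.sup A1 with hB
  have hBA : ∀ b : ι → ℕ, (∀ i, B ≤ b i) → ∀ i, A ≤ b i := fun b hb i =>
    (Nat.le_add_right _ _).trans (hb i)
  have hinj : ∀ b : ι → ℕ, (∀ i, B ≤ b i) → ∀ i, ∀ g ∈ Gr n b, g * l i ∈ I → g ∈ I := by
    intro b hb i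
    refine hA1 i b fun k => le_trans ?_ (hb k)
    exact (Finset.le_sup (Finset.mem_univ i)).trans (Nat.le_add_left _ _)
  -- the monoid of eventually injective forms
  let Mn : Submonoid (Sg n) :=
    { carrier := {q | (∃ d, q ∈ Gr n d) ∧ ∀ b : ι → ℕ, (∀ i, B ≤ b i) → ∀ x ∈ Vq I b,
        x * Ideal.Quotient.mk I q = 0 → x = 0}
      one_mem' := ⟨⟨0, isWeightedHomogeneous_one ℝ (wt n)⟩, fun b hb x hx h => by simpa using h⟩
      mul_mem' := by
        rintro p q ⟨⟨d, hd⟩, hp⟩ ⟨⟨e, he⟩, hq⟩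
        refine ⟨⟨d + e, mul_mem_Gr hd he⟩, fun b hb x hx h => ?_⟩
        rw [map_mul, ← mul_assoc] at h
        have h' := hq (b + d) (fun i => (hb i).trans (Nat.le_add_right _ _)) _ (mul_mem_Vq hx hd) h
        exact hp b hb x hx h' }
  have hlM : ∀ i, l i ∈ Mn := by
    intro i
    refine ⟨⟨_, hl i⟩, fun b hb x hx h => ?_⟩
    obtain ⟨g, hg, rfl⟩ := mem_Vq.1 hx
    rw [← map_mul, Ideal.Quotient.eq_zero_iff_mem] at h
    exact Ideal.Quotient.eq_zero_iff_mem.2 (hinj b hb i g hg h)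
  have hcan : ∀ q ∈ Mn, ∀ b : ι → ℕ, (∀ i, B ≤ b i) → ∀ x ∈ Vq I b,
        x * Ideal.Quotient.mk I q = 0 → x = 0 := fun q hq => hq.2
  let a : ι → ℕ := fun _ => B
  have ha : ∀ i, B ≤ a i := fun i => le_rfl
  have ha' : ∀ k i, B ≤ (a + Pi.single k 1 : ι → ℕ) i := fun k i => Nat.le_add_right _ _
  have hfr : ∀ i, Module.finrank ℝ (Vq I a) = Module.finrank ℝ (Vq I (a + Pi.single i 1)) := by
    intro i
    exact (hH a (hBA a ha)).trans (hH _ (hBA _ (ha' i))).symm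
  let E : ∀ i, Vq I a ≃ₗ[ℝ] Vq I (a + Pi.single i 1) := fun i =>
    LinearEquiv.ofInjectiveOfFinrankEq (mulV I (hl i) a) (mulV_inj (hl i) (hinj a ha i)) (hfr i)
  have hE : ∀ i w, E i w = mulV I (hl i) a w := fun i w => rfl
  let M : Vr n → Vq I a →ₗ[ℝ] Vq I a := fun s =>
    (E s.1).symm.toLinearMap ∘ₗ mulV I (X_mem_Gr s) a
  have hM : ∀ s w, (M s w : Sg n ⧸ I) * Ideal.Quotient.mk I (l s.1) = w * Ideal.Quotient.mk I (X s) := by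
    intro s w
    have : E s.1 (M s w) = mulV I (X_mem_Gr s) a w := by
      simp only [M, LinearMap.comp_apply, LinearEquiv.coe_coe, LinearEquiv.apply_symm_apply]
    rw [hE] at this
    exact congrArg Subtype.val this
  have hcomm : ∀ s t w, M s (M t w) = M t (M s w) := by
    intro s t w
    rw [← sub_eq_zero]
    refine Subtype.ext (hcan (l s.1 * l t.1) (Mn.mul_mem (hlM _) (hlM _)) a ha _ (Subtype.mem _) ?_)
    rw [Submodule.coe_sub, sub_mul, sub_eq_zero, map_mul]
    calc (M s (M t w) : Sg n ⧸ I) * (Ideal.Quotient.mk I (l s.1) * Ideal.Quotient.mk I (l t.1))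
        = (M s (M t w) : Sg n ⧸ I) * Ideal.Quotient.mk I (l s.1) * Ideal.Quotient.mk I (l t.1) := by ring
      _ = (M t w : Sg n ⧸ I) * Ideal.Quotient.mk I (l t.1) * Ideal.Quotient.mk I (X s) := by
          rw [hM]; ring
      _ = (M s w : Sg n ⧸ I) * Ideal.Quotient.mk I (l s.1) * Ideal.Quotient.mk I (X t) := by
          rw [hM, hM]; ring
      _ = (M t (M s w) : Sg n ⧸ I) * Ideal.Quotient.mk I (l t.1) * Ideal.Quotient.mk I (l s.1) := by
          rw [hM t (M s w)]; ring
      _ = _ := by ring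
  obtain ⟨v, hv, z, hz⟩ := common_eigenvector c (Vq I a) M hcomm (hH a (hBA a ha)) hc
  let φ : Sg n →ₐ[ℝ] Sg n := aeval fun s : Vr n => l s.1 * C (z s)
  have hφ : ∀ p, (v : Sg n ⧸ I) * Ideal.Quotient.mk I p = v * Ideal.Quotient.mk I (φ p) := by
    intro p
    induction p using MvPolynomial.induction_on with
    | C r => simp only [φ, aeval_C]; rfl
    | add p q hp hq => simp only [map_add, mul_add, hp, hq]
    | mul_X p s hp =>
      have h3 : (v : Sg n ⧸ I) * Ideal.Quotient.mk I (X s) = v * Ideal.Quotient.mk I (φ (X s)) := by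
        rw [← hM, hz]
        simp only [φ, aeval_X, map_mul, Submodule.coe_smul]
        obtain ⟨g, hg, hgv⟩ := mem_Vq.1 v.2
        have h31 : (z s • (v : Sg n ⧸ I)) = Ideal.Quotient.mk I (C (z s)) * v := by
          rw [← hgv]
          change Ideal.Quotient.mk I (z s • g) = _
          rw [smul_eq_C_mul, map_mul]
        rw [h31]; ring
      calc (v : Sg n ⧸ I) * Ideal.Quotient.mk I (p * X s)
          = (v * Ideal.Quotient.mk I (X s)) * Ideal.Quotient.mk I p := by rw [map_mul]; ring
        _ = (v * Ideal.Quotient.mk I p) * Ideal.Quotient.mk I (φ (X s)) := by rw [h3]; ring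
        _ = _ := by rw [hp, map_mul, map_mul]; ring
  have hφ2 : ∀ e, ∀ F ∈ Gr n e, φ F = (∏ i, l i ^ e i) * C (eval z F) := by
    intro e F hF
    have := aeval_scale hF (fun s => (C (z s) : Sg n)) l
    simp only [φ]
    rw [this]
    congr 1
    have h4 := aeval_algebraMap_apply (B := Sg n) z F
    simpa [Function.comp_def, MvPolynomial.algebraMap_eq, aeval_eq_eval] using h4
  have hv0 : (v : Sg n ⧸ I) ≠ 0 := fun h => hv (Subtype.ext h)
  have key : ∀ e, ∀ F ∈ Gr n e, (v : Sg n ⧸ I) * Ideal.Quotient.mk I F = 0 → eval z F = 0 := by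
    intro e F hF h0
    by_contra hne
    rw [hφ, hφ2 e F hF, map_mul, ← mul_assoc] at h0
    have hu : (Ideal.Quotient.mk I (C (eval z F)) : Sg n ⧸ I) * Ideal.Quotient.mk I (C (eval z F)⁻¹) = 1 := by
      rw [← map_mul, ← C_mul, mul_inv_cancel₀ hne, C_1, map_one]
    have h5 : (v : Sg n ⧸ I) * Ideal.Quotient.mk I (∏ i, l i ^ e i) = 0 := by
      have := congrArg (· * Ideal.Quotient.mk I (C (eval z F)⁻¹)) h0
      simpa [mul_assoc, hu] using this
    exact hv0 (hcan _ (Submonoid.prod_mem _ fun i _ => Submonoid.pow_mem _ (hlM i) _) a ha _ v.2 h5)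
  refine ⟨z, fun i => ?_, fun e F hF hFI => ?_⟩
  · by_contra hcon
    push Not at hcon
    have h6 : eval z (l i) = 0 := by
      have := aeval_scale (hl i) z (Function.update 1 i 0)
      have h7 : (fun s : Vr n => (Function.update 1 i 0 : ι → ℝ) s.1 * z s) = z := by
        funext s
        by_cases hs : s.1 = i
        · obtain ⟨k, j⟩ := s
          simp only at hs
          subst hs
          rw [hcon j, mul_zero]
        · rw [Function.update_of_ne hs, Pi.one_apply, one_mul]
      rw [h7, Finset.prod_eq_zero (Finset.mem_univ i) (by simp), zero_mul] at this
      simpa [aeval_eq_eval] using this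
    have h8 : (v : Sg n ⧸ I) * Ideal.Quotient.mk I (l i) = 0 := by
      rw [hφ, hφ2 _ _ (hl i), h6]; simp
    exact hv0 (hcan _ (hlM i) a ha _ v.2 h8)
  · refine key e F hF ?_
    rw [Ideal.Quotient.eq_zero_iff_mem.2 hFI, mul_zero]

end BU

namespace BU
open MvPolynomial

variable {ι : Type} [Fintype ι] [DecidableEq ι] {n : ι → ℕ}

/-- The exponent vector as a finitely supported function. -/
def fs (n : ι → ℕ) : ι →₀ ℕ := Finsupp.equivFunOnFinite.symm n

/-- `∏ (1 + Y_i)^(b i)`. -/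
def up (b : ι → ℕ) : MvPolynomial ι ℤ := ∏ i, (1 + X i) ^ b i

lemma up_add (a b : ι → ℕ) : up (a + b) = up a * up b := by
  simp [up, pow_add, Finset.prod_mul_distrib]

lemma coeff_up (b n : ι → ℕ) : coeff (fs n) (up b) = ((∏ i, (b i).choose (n i) : ℕ) : ℤ) := by
  have h1 : ∀ i, (1 + X i : MvPolynomial ι ℤ) ^ b i =
      ∑ k ∈ Finset.range (max (b i) (n i) + 1), X i ^ k * C (((b i).choose k : ℕ) : ℤ) := by
    intro i
    rw [add_comm, add_pow]
    rw [Finset.sum_subset (Finset.range_subset_range.2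
      (Nat.succ_le_succ (le_max_left (b i) (n i))))]
    · refine Finset.sum_congr rfl fun k _ => ?_
      simp
    · intro k _ hk
      rw [Nat.choose_eq_zero_of_lt (by simpa using hk)]; simp
  unfold up
  simp_rw [h1]
  rw [Finset.prod_univ_sum, coeff_sum]
  have h2 : ∀ κ : ι → ℕ, (∏ i, (X i ^ κ i * C (((b i).choose (κ i) : ℕ) : ℤ)) : MvPolynomial ι ℤ) =
      monomial (fs κ) ((∏ i, (b i).choose (κ i) : ℕ) : ℤ) := by
    intro κ
    rw [monomial_eq, Finsupp.prod_fintype _ _ (by simp), Finset.prod_mul_distrib, mul_comm]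
    simp [fs, map_prod]
  simp_rw [h2, coeff_monomial]
  rw [Finset.sum_eq_single n]
  · simp
  · intro κ _ hκ
    rw [if_neg]
    intro h
    exact hκ (Finsupp.equivFunOnFinite.symm.injective h)
  · intro h
    exfalso
    apply h
    simp

/-- The augmentation ideal. -/
abbrev mm (ι : Type) : Ideal (MvPolynomial ι ℤ) := idealOfVars ι ℤ

lemma X_mem_mm (i : ι) : (X i : MvPolynomial ι ℤ) ∈ mm ι := Ideal.subset_span ⟨i, rfl⟩

lemma coeff_of_mem {k : ℕ} {p : MvPolynomial ι ℤ} (hp : p ∈ mm ι ^ k) (hk : ∑ i, n i < k) :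
    coeff (fs n) p = 0 := by
  refine (mem_pow_idealOfVars_iff' k p).1 hp (fs n) ?_
  rw [Finsupp.degree_eq_sum]
  exact hk

lemma one_pow_sub (i : ι) (d : ℕ) : ((1 + X i) ^ d - 1 - C (d : ℤ) * X i : MvPolynomial ι ℤ) ∈ mm ι ^ 2 := by
  induction d with
  | zero => simp
  | succ d ih =>
    have : ((1 + X i) ^ (d + 1) - 1 - C ((d + 1 : ℕ) : ℤ) * X i : MvPolynomial ι ℤ) =
        ((1 + X i) ^ d - 1 - C (d : ℤ) * X i) * (1 + X i) + C (d : ℤ) * (X i ^ 2) := by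
      push_cast; rw [C_add, C_1]; ring
    rw [this]
    exact Ideal.add_mem _ (Ideal.mul_mem_right _ _ ih)
      (Ideal.mul_mem_left _ _ (Ideal.pow_mem_pow (X_mem_mm i) 2))

lemma up_sub (d : ι → ℕ) : (up d - 1 - ∑ i, C (d i : ℤ) * X i) ∈ mm ι ^ 2 := by
  unfold up
  induction (Finset.univ : Finset ι) using Finset.induction_on with
  | empty => simp
  | insert i s hi ih =>
    rw [Finset.prod_insert hi, Finset.sum_insert hi]
    set P := ∏ i ∈ s, (1 + X i : MvPolynomial ι ℤ) ^ d i
    set L := ∑ i ∈ s, C (d i : ℤ) * (X i : MvPolynomial ι ℤ)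
    have hL : L ∈ mm ι := Ideal.sum_mem _ fun k _ => Ideal.mul_mem_left _ _ (X_mem_mm k)
    have h1 := one_pow_sub i (d i)
    have : (1 + X i) ^ d i * P - 1 - (C (d i : ℤ) * X i + L) =
        ((1 + X i) ^ d i - 1 - C (d i : ℤ) * X i) * P + (1 + C (d i : ℤ) * X i) * (P - 1 - L)
          + C (d i : ℤ) * (X i * L) := by ring
    rw [this]
    refine Ideal.add_mem _ (Ideal.add_mem _ (Ideal.mul_mem_right _ _ h1) (Ideal.mul_mem_left _ _ ih))
      (Ideal.mul_mem_left _ _ ?_)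
    rw [pow_two]
    exact Ideal.mul_mem_mul (X_mem_mm i) hL

lemma up_sub_one (d : ι → ℕ) : up d - 1 ∈ mm ι := by
  have h := Ideal.pow_le_self (two_ne_zero) (up_sub d)
  have : up d - 1 = (up d - 1 - ∑ i, C (d i : ℤ) * X i) + ∑ i, C (d i : ℤ) * X i := by ring
  rw [this]
  exact Ideal.add_mem _ h (Ideal.sum_mem _ fun k _ => Ideal.mul_mem_left _ _ (X_mem_mm k))

lemma prod_congr_mm {J : Type} (t : Finset J) (p q : J → MvPolynomial ι ℤ) (hp : ∀ j, p j ∈ mm ι)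
    (hpq : ∀ j, p j - q j ∈ mm ι ^ 2) :
    (∏ j ∈ t, p j) ∈ mm ι ^ t.card ∧ (∏ j ∈ t, p j) - (∏ j ∈ t, q j) ∈ mm ι ^ (t.card + 1) := by
  classical
  have hq : ∀ j, q j ∈ mm ι := fun j => by
    have := Ideal.sub_mem _ (hp j) (Ideal.pow_le_self two_ne_zero (hpq j))
    simpa using this
  induction t using Finset.induction_on with
  | empty => simp
  | insert j s hj ih =>
    rw [Finset.prod_insert hj, Finset.prod_insert hj, Finset.card_insert_of_notMem hj]
    constructor
    · rw [pow_succ']; exact Ideal.mul_mem_mul (hp j) ih.1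
    · have : p j * (∏ j ∈ s, p j) - q j * (∏ j ∈ s, q j) =
        (p j - q j) * (∏ j ∈ s, p j) + q j * ((∏ j ∈ s, p j) - (∏ j ∈ s, q j)) := by ring
      rw [this]
      refine Ideal.add_mem _ ?_ ?_
      · rw [show s.card + 1 + 1 = 2 + s.card by ring, pow_add]
        exact Ideal.mul_mem_mul (hpq j) ih.1
      · rw [pow_succ']; exact Ideal.mul_mem_mul (hq j) ih.2

lemma coeff_const {J : Type} [Fintype J] (d : J → ι → ℕ) (hJ : Fintype.card J = ∑ i, n i) (b : ι → ℕ) :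
    coeff (fs n) (up b * ∏ j, (up (d j) - 1)) =
      coeff (fs n) (∏ j, ∑ i, C (d j i : ℤ) * X i : MvPolynomial ι ℤ) := by
  obtain ⟨h1, h2⟩ := prod_congr_mm Finset.univ (fun j => up (d j) - 1)
    (fun j => ∑ i, C (d j i : ℤ) * X i) (fun j => up_sub_one _) (fun j => up_sub _)
  have h3 : up b * ∏ j, (up (d j) - 1) - (∏ j, ∑ i, C (d j i : ℤ) * X i) ∈
      mm ι ^ ((Finset.univ : Finset J).card + 1) := by
    have : up b * ∏ j, (up (d j) - 1) - (∏ j, ∑ i, C (d j i : ℤ) * X i) =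
      (up b - 1) * ∏ j, (up (d j) - 1) + (∏ j, (up (d j) - 1) - (∏ j, ∑ i, C (d j i : ℤ) * X i)) := by
      ring
    rw [this]
    refine Ideal.add_mem _ ?_ h2
    rw [pow_succ']; exact Ideal.mul_mem_mul (up_sub_one _) h1
  have h4 := coeff_of_mem (n := n) h3 (by rw [Finset.card_univ, hJ]; exact Nat.lt_succ_self _)
  rw [coeff_sub] at h4
  exact sub_eq_zero.1 h4

/-- Bound on compact sets. -/
lemma chain {J : Type} [DecidableEq J] (K : Set (Vr n → ℝ)) (hK : IsCompact K) (d : J → ι → ℕ)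
    (f : J → Sg n) (hf : ∀ j, f j ∈ Gr n (d j)) {ε : ℝ} (hε : 0 < ε) (t : Finset J) :
    ∃ I : Ideal (Sg n), IsHom I ∧
      (∀ j ∈ t, ∃ g ∈ Gr n (d j), g ∈ I ∧ ∀ z ∈ K, |eval z (f j) - eval z g| ≤ ε) ∧
      ∃ A : ℕ, ∀ a : ι → ℕ, (∀ i, A ≤ a i) →
        (hilb I (a + ∑ j ∈ t, d j) : ℤ) = coeff (fs n) (up (a + n) * ∏ j ∈ t, (up (d j) - 1)) := by
  induction t using Finset.induction_on with
  | empty =>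
    refine ⟨⊥, isHom_bot, by simp, 0, fun a _ => ?_⟩
    rw [Finset.sum_empty, Finset.prod_empty, add_zero, mul_one, hilb_bot, coeff_up]
    rfl
  | insert j s hj ih =>
    obtain ⟨I, hI, hg, A, hA⟩ := ih
    obtain ⟨g, hgd, hgt⟩ := exists_avoid_near I (hf j)
    obtain ⟨M, hM⟩ : ∃ M : ℝ, ∀ z ∈ K, |eval z g| ≤ M := by
      obtain ⟨M, hM⟩ := hK.exists_bound_of_continuousOn (f := fun z => eval z g)
        (MvPolynomial.continuous_eval g).continuousOn
      exact ⟨M, fun z hz => hM z hz⟩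
    obtain ⟨u, hu0, hu1, hav⟩ := hgt (ε / (|M| + 1)) (by positivity)
    have hmem : f j + u • g ∈ Gr n (d j) := Submodule.add_mem _ (hf j) (Submodule.smul_mem _ _ hgd)
    obtain ⟨B, hB⟩ := eventually_inj hI hmem hav
    refine ⟨I ⊔ Ideal.span {f j + u • g}, isHom_sup_span hI hmem, ?_, A + B, fun a ha => ?_⟩
    · intro k hk
      rcases Finset.mem_insert.1 hk with rfl | hk
      · refine ⟨_, hmem, Ideal.mem_sup_right (Ideal.subset_span rfl), fun z hz => ?_⟩
        have h1 := hM z hz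
        have : eval z (f k) - eval z (f k + u • g) = -(u * eval z g) := by
          rw [map_add, smul_eval]; ring
        rw [this, abs_neg, abs_mul, abs_of_pos hu0]
        have h2 : |eval z g| ≤ |M| + 1 := h1.trans ((le_abs_self M).trans (by linarith))
        calc u * |eval z g| ≤ ε / (|M| + 1) * (|M| + 1) := by gcongr
          _ = ε := by field_simp
      · obtain ⟨g', h1, h2, h3⟩ := hg k hk
        exact ⟨g', h1, Ideal.mem_sup_left h2, h3⟩
    · have hst := hilb_step hI hmem (a := a + ∑ j ∈ s, d j) (hB _ fun i =>
        le_trans (le_trans (Nat.le_add_left _ _) (ha i)) (Nat.le_add_right _ _))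
      have hA1 := hA a fun i => (Nat.le_add_right _ _).trans (ha i)
      have hA2 := hA (a + d j) fun i => ((Nat.le_add_right _ _).trans (ha i)).trans (Nat.le_add_right _ _)
      rw [Finset.sum_insert hj, Finset.prod_insert hj]
      have e1 : a + (d j + ∑ x ∈ s, d x) = a + ∑ x ∈ s, d x + d j := by abel
      have e2 : a + d j + ∑ x ∈ s, d x = a + ∑ x ∈ s, d x + d j := by abel
      have e3 : a + d j + n = (a + n) + d j := by abel
      rw [e2, e3, up_add, hst] at hA2
      rw [e1]
      push_cast at hA2
      rw [show up (a + n) * ((up (d j) - 1) * ∏ x ∈ s, (up (d x) - 1)) =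
        up (a + n) * up (d j) * (∏ x ∈ s, (up (d x) - 1)) - up (a + n) * ∏ x ∈ s, (up (d x) - 1) by ring,
        coeff_sub, ← hA1, ← hA2]
      ring

/-- Product of spheres. -/
def Xs (n : ι → ℕ) : Set (Vr n → ℝ) := {z | ∀ i, ∑ j, z ⟨i, j⟩ ^ 2 = 1}

lemma isCompact_Xs : IsCompact (Xs n) := by
  have hsub : Xs n ⊆ Set.pi Set.univ (fun _ : Vr n => Set.Icc (-1 : ℝ) 1) := by
    rintro z hz ⟨i, j⟩ _
    have h1 := hz i
    have h2 : z ⟨i, j⟩ ^ 2 ≤ 1 := by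
      rw [← h1]
      exact Finset.single_le_sum (f := fun j => z ⟨i, j⟩ ^ 2) (fun _ _ => sq_nonneg _) (Finset.mem_univ j)
    exact abs_le.1 ((sq_le_one_iff_abs_le_one _).1 h2)
  refine IsCompact.of_isClosed_subset (isCompact_univ_pi fun _ => isCompact_Icc) ?_ hsub
  have : Xs n = ⋂ i, {z | ∑ j, z ⟨i, j⟩ ^ 2 = 1} := by ext; simp [Xs]
  rw [this]
  refine isClosed_iInter fun i => isClosed_eq ?_ continuous_const
  fun_prop

theorem poly_BU {J : Type} [Fintype J] [DecidableEq J] (d : J → ι → ℕ)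
    (hJ : Fintype.card J = ∑ i, n i)
    (hodd : coeff (fs n) (∏ j, ∑ i, C (d j i : ZMod 2) * X i : MvPolynomial ι (ZMod 2)) = 1)
    (f : J → Sg n) (hf : ∀ j, f j ∈ Gr n (d j)) {ε : ℝ} (hε : 0 < ε) :
    ∃ z ∈ Xs n, ∀ j, |eval z (f j)| ≤ ε := by
  obtain ⟨I, hI, hg, A, hA⟩ := chain (Xs n) isCompact_Xs d f hf hε Finset.univ
  set c : ℤ := coeff (fs n) (∏ j, ∑ i, C (d j i : ℤ) * X i : MvPolynomial ι ℤ) with hc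
  have hc2 : (c : ZMod 2) = 1 := by
    rw [← hodd, hc]
    have := coeff_map (Int.castRingHom (ZMod 2)) (∏ j, ∑ i, C (d j i : ℤ) * X i : MvPolynomial ι ℤ) (fs n)
    rw [eq_intCast] at this
    rw [← this, map_prod]
    congr 1
    refine Finset.prod_congr rfl fun j _ => ?_
    rw [map_sum]
    refine Finset.sum_congr rfl fun i _ => ?_
    simp
  have hA' : ∀ a : ι → ℕ, (∀ i, A + (∑ j, d j) i ≤ a i) → (hilb I a : ℤ) = c := by
    intro a ha
    have hle : ∑ j, d j ≤ a := fun i => (Nat.le_add_left _ _).trans (ha i)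
    obtain ⟨e, rfl⟩ := exists_add_of_le hle
    rw [add_comm, hA e, coeff_const d hJ]
    intro i
    have := ha i
    rw [Pi.add_apply] at this
    omega
  obtain ⟨z, hz0, hz⟩ := real_point hI (A + Finset.univ.sup (∑ j, d j)) c.toNat (by
      have h1 := hA' (fun i => A + (∑ j, d j) i) (fun i => le_rfl)
      have h2 : c.toNat = hilb I (fun i => A + (∑ j, d j) i) := by omega
      rw [h2, ← ZMod.natCast_eq_one_iff_odd, ← hc2, ← h1]
      simp) (by
      intro a ha
      have := hA' a (fun i => le_trans (Nat.add_le_add_left (Finset.le_sup (Finset.mem_univ i)) _) (ha i))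
      omega)
  have hpos : ∀ i, 0 < ∑ j, z ⟨i, j⟩ ^ 2 := by
    intro i
    obtain ⟨j, hj⟩ := hz0 i
    exact Finset.sum_pos' (fun _ _ => sq_nonneg _) ⟨j, Finset.mem_univ _, by positivity⟩
  let r : ι → ℝ := fun i => (Real.sqrt (∑ j, z ⟨i, j⟩ ^ 2))⁻¹
  have hz' : (fun s : Vr n => r s.1 * z s) ∈ Xs n := by
    intro i
    simp only [mul_pow]
    rw [← Finset.mul_sum]
    simp only [r]
    rw [inv_pow, Real.sq_sqrt (hpos i).le, inv_mul_cancel₀ (hpos i).ne']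
  refine ⟨_, hz', fun j => ?_⟩
  obtain ⟨g, hgd, hgI, hgz⟩ := hg j (Finset.mem_univ j)
  have h1 := hgz _ hz'
  have h2 := aeval_scale hgd z r
  rw [aeval_eq_eval, aeval_eq_eval] at h2
  rw [h2, hz _ g hgd hgI, mul_zero, sub_zero] at h1
  exact h1

end BU

namespace BU
open MvPolynomial

variable {ι : Type} [Fintype ι] [DecidableEq ι] {n : ι → ℕ}

/-- The action of scalars on blocks. -/
def act (g : ι → ℝ) (z : Vr n → ℝ) : Vr n → ℝ := fun s => g s.1 * z s

lemma act_mem {g : ι → ℝ} (hg : ∀ i, g i ^ 2 = 1) {z : Vr n → ℝ} (hz : z ∈ Xs n) : act g z ∈ Xs n := by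
  intro i
  have := hz i
  simp only [act, mul_pow, hg, one_mul]
  exact this

lemma eval_act {a : ι → ℕ} {p : Sg n} (hp : p ∈ Gr n a) (g : ι → ℝ) (z : Vr n → ℝ) :
    eval (act g z) p = (∏ i, g i ^ a i) * eval z p := by
  have h2 := aeval_scale hp z g
  rw [aeval_eq_eval, aeval_eq_eval] at h2
  exact h2

lemma pow_mem_Gr {a : ι → ℕ} {p : Sg n} (hp : p ∈ Gr n a) (k : ℕ) : p ^ k ∈ Gr n (k • a) := by
  induction k with
  | zero => rw [pow_zero, zero_smul]; exact isWeightedHomogeneous_one ℝ (wt n)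
  | succ k ih => rw [pow_succ, succ_nsmul]; exact mul_mem_Gr ih hp

lemma prod_mem_Gr (t : Finset ι) (a : ι → ι → ℕ) (p : ι → Sg n) (hp : ∀ i, p i ∈ Gr n (a i)) :
    ∏ i ∈ t, p i ∈ Gr n (∑ i ∈ t, a i) := by
  induction t using Finset.induction_on with
  | empty => rw [Finset.prod_empty, Finset.sum_empty]; exact isWeightedHomogeneous_one ℝ (wt n)
  | insert i s hi ih => rw [Finset.prod_insert hi, Finset.sum_insert hi]; exact mul_mem_Gr (hp i) ih

/-- The squared norm of a block. -/
def nrm (n : ι → ℕ) (i : ι) : Sg n := ∑ j, X ⟨i, j⟩ ^ 2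

lemma nrm_mem (i : ι) : nrm n i ∈ Gr n (2 • Pi.single i 1) :=
  Submodule.sum_mem _ fun j _ => pow_mem_Gr (X_mem_Gr (n := n) ⟨i, j⟩) 2

lemma eval_nrm {z : Vr n → ℝ} (hz : z ∈ Xs n) (i : ι) : eval z (nrm n i) = 1 := by
  rw [nrm, map_sum, ← hz i]
  simp

lemma homog {a D : ι → ℕ} {p : Sg n} (hp : p ∈ Gr n a) (k : ι → ℕ) (hk : ∀ i, D i = a i + 2 * k i) :
    ∃ q ∈ Gr n D, ∀ z ∈ Xs n, eval z q = eval z p := by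
  refine ⟨p * ∏ i, nrm n i ^ k i, ?_, fun z hz => ?_⟩
  · have h1 := mul_mem_Gr hp (prod_mem_Gr Finset.univ _ _ fun i => pow_mem_Gr (nrm_mem (n := n) i) (k i))
    convert h1 using 2
    funext i
    rw [hk, Pi.add_apply, Finset.sum_apply, Finset.sum_eq_single i]
    · simp [mul_comm]
    · intro b _ hb
      simp [hb.symm]
    · simp
  · rw [map_mul, map_prod]
    simp [eval_nrm hz]

/-- Signs as reals. -/
def sg (g : ι → ℤˣ) : ι → ℝ := fun i => ((g i : ℤ) : ℝ)

lemma sg_sq (g : ι → ℤˣ) (i : ι) : sg g i ^ 2 = 1 := by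
  rcases Int.units_eq_one_or (g i) with h | h <;> simp [sg, h]

/-- Averaging with respect to a character. -/
def av (α : ι → ℕ) (F : (Vr n → ℝ) → ℝ) (z : Vr n → ℝ) : ℝ :=
  ((2 : ℝ) ^ Fintype.card ι)⁻¹ * ∑ g : ι → ℤˣ, (∏ i, sg g i ^ α i) * F (act (sg g) z)

lemma sum_sg (b : ι → ℕ) : ∑ g : ι → ℤˣ, ∏ i, sg g i ^ b i = ∏ i, (1 + (-1 : ℝ) ^ b i) := by
  have h := Finset.prod_univ_sum (fun _ : ι => (Finset.univ : Finset ℤˣ))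
    (fun i u => (((u : ℤ) : ℝ)) ^ b i)
  rw [Fintype.piFinset_univ] at h
  simp only [sg]
  rw [← h]
  refine Finset.prod_congr rfl fun i _ => ?_
  have : (Finset.univ : Finset ℤˣ) = {1, -1} := rfl
  rw [this, Finset.sum_pair (by decide)]
  simp

lemma av_mono {α a : ι → ℕ} {p : Sg n} (hp : p ∈ Gr n a) (z : Vr n → ℝ) :
    av α (fun z => eval z p) z = if ∀ i, Even (a i + α i) then eval z p else 0 := by
  unfold av
  have h1 : ∀ g : ι → ℤˣ, (∏ i, sg g i ^ α i) * eval (act (sg g) z) p =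
      (∏ i, sg g i ^ (a i + α i)) * eval z p := by
    intro g
    rw [eval_act hp, ← mul_assoc, ← Finset.prod_mul_distrib]
    congr 1
    refine Finset.prod_congr rfl fun i _ => ?_
    rw [← pow_add, add_comm]
  simp_rw [h1]
  rw [← Finset.sum_mul, sum_sg]
  split_ifs with h
  · have : ∀ i, (1 + (-1 : ℝ) ^ (a i + α i)) = 2 := fun i => by rw [(h i).neg_one_pow]; norm_num
    simp_rw [this]
    rw [Finset.prod_const, Finset.card_univ, ← mul_assoc, inv_mul_cancel₀ (by positivity), one_mul]
  · push Not at h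
    obtain ⟨i, hi⟩ := h
    rw [Finset.prod_eq_zero (Finset.mem_univ i), zero_mul, mul_zero]
    rw [(Nat.not_even_iff_odd.1 hi).neg_one_pow]; norm_num

lemma av_poly (α : ι → ℕ) (p : Sg n) : ∃ N0 : ℕ, ∀ N, N0 ≤ N →
    ∃ q ∈ Gr n (fun i => α i + 2 * N), ∀ z ∈ Xs n, eval z q = av α (fun z => eval z p) z := by
  induction p using MvPolynomial.induction_on' with
  | monomial u r =>
    have hp := monomial_mem_Gr (n := n) u r
    set a := Finsupp.weight (wt n) u
    by_cases h : ∀ i, Even (a i + α i)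
    · refine ⟨Finset.univ.sup a, fun N hN => ?_⟩
      obtain ⟨q, hq, hqz⟩ := homog (D := fun i => α i + 2 * N) hp (fun i => (α i + 2 * N - a i) / 2) (by
        intro i
        have h1 : a i ≤ Finset.univ.sup a := Finset.le_sup (Finset.mem_univ i)
        have := Nat.even_iff.1 (h i)
        omega)
      refine ⟨q, hq, fun z hz => ?_⟩
      rw [hqz z hz, av_mono hp, if_pos h]
    · refine ⟨0, fun N _ => ⟨0, Submodule.zero_mem _, fun z _ => ?_⟩⟩
      rw [av_mono hp, if_neg h, map_zero]
  | add p q hp hq =>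
    obtain ⟨N1, h1⟩ := hp
    obtain ⟨N2, h2⟩ := hq
    refine ⟨N1 + N2, fun N hN => ?_⟩
    obtain ⟨p', hp', hp2⟩ := h1 N (by omega)
    obtain ⟨q', hq', hq2⟩ := h2 N (by omega)
    refine ⟨p' + q', Submodule.add_mem _ hp' hq', fun z hz => ?_⟩
    rw [map_add, hp2 z hz, hq2 z hz]
    simp only [av, map_add, mul_add, Finset.sum_add_distrib]

/-- Stone-Weierstrass on the product of spheres. -/
lemma weier (f : (Vr n → ℝ) → ℝ) (hf : ContinuousOn f (Xs n)) {ε : ℝ} (hε : 0 < ε) :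
    ∃ p : Sg n, ∀ z ∈ Xs n, |eval z p - f z| < ε := by
  have : CompactSpace (Xs n) := isCompact_iff_compactSpace.1 isCompact_Xs
  let cf : Vr n → C(Xs n, ℝ) := fun s => ⟨fun z => z.1 s, (continuous_apply s).comp continuous_subtype_val⟩
  let Φ : Sg n →ₐ[ℝ] C(Xs n, ℝ) := aeval cf
  have hΦ : ∀ p z, Φ p z = eval z.1 p := by
    intro p z
    induction p using MvPolynomial.induction_on with
    | C r => simp [Φ]
    | add p q hp hq => rw [map_add, ContinuousMap.add_apply, hp, hq, map_add]
    | mul_X p s hp => rw [map_mul, ContinuousMap.mul_apply, hp, map_mul]; simp [Φ, cf]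
  have hsep : Φ.range.SeparatesPoints := by
    intro x y hxy
    have : ∃ s, x.1 s ≠ y.1 s := by
      by_contra h
      push Not at h
      exact hxy (Subtype.ext (funext h))
    obtain ⟨s, hs⟩ := this
    refine ⟨Φ (X s), ⟨_, ⟨X s, rfl⟩, rfl⟩, ?_⟩
    rw [hΦ, hΦ]; simpa using hs
  obtain ⟨⟨g, p, rfl⟩, hg⟩ := ContinuousMap.exists_mem_subalgebra_near_continuousMap_of_separatesPoints
    Φ.range hsep ⟨fun z => f z.1, continuousOn_iff_continuous_domRestrict.1 hf⟩ ε hε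
  refine ⟨p, fun z hz => ?_⟩
  have h1 := ContinuousMap.norm_coe_le_norm (Φ p - ⟨fun z => f z.1, continuousOn_iff_continuous_domRestrict.1 hf⟩ : C(Xs n, ℝ)) ⟨z, hz⟩
  refine lt_of_le_of_lt ?_ hg
  refine le_trans (le_of_eq ?_) h1
  rw [ContinuousMap.sub_apply, Real.norm_eq_abs, hΦ]
  rfl

lemma approx (α : ι → ℕ) (f : (Vr n → ℝ) → ℝ) (hf : ContinuousOn f (Xs n))
    (hodd : ∀ g : ι → ℤˣ, ∀ z ∈ Xs n, f (act (sg g) z) = (∏ i, sg g i ^ α i) * f z)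
    {ε : ℝ} (hε : 0 < ε) :
    ∃ N : ℕ, ∃ q ∈ Gr n (fun i => α i + 2 * N), ∀ z ∈ Xs n, |eval z q - f z| ≤ ε := by
  obtain ⟨p, hp⟩ := weier f hf hε
  obtain ⟨N, hN⟩ := av_poly α p
  obtain ⟨q, hq, hqz⟩ := hN N le_rfl
  refine ⟨N, q, hq, fun z hz => ?_⟩
  have hc : (((Finset.univ : Finset (ι → ℤˣ)).card : ℕ) : ℝ) = (2 : ℝ) ^ Fintype.card ι := by
    rw [Finset.card_univ, Fintype.card_fun]
    have : Fintype.card ℤˣ = 2 := rfl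
    rw [this]; simp
  have hpos : (0 : ℝ) < 2 ^ Fintype.card ι := by positivity
  have h1 : f z = ((2 : ℝ) ^ Fintype.card ι)⁻¹ * ∑ g : ι → ℤˣ, f z := by
    rw [Finset.sum_const, nsmul_eq_mul, hc, ← mul_assoc, inv_mul_cancel₀ hpos.ne', one_mul]
  have habs : ∀ g : ι → ℤˣ, |∏ i, sg g i ^ α i| = 1 := by
    intro g
    rw [Finset.abs_prod]
    refine Finset.prod_eq_one fun i _ => ?_
    rw [abs_pow]
    have : |sg g i| = 1 := by
      rcases Int.units_eq_one_or (g i) with h | h <;> simp [sg, h]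
    rw [this, one_pow]
  rw [hqz z hz, h1, av, ← mul_sub, ← Finset.sum_sub_distrib, abs_mul, abs_of_pos (inv_pos.2 hpos),
    inv_mul_le_iff₀ hpos, ← hc]
  refine (Finset.abs_sum_le_sum_abs _ _).trans ?_
  rw [← nsmul_eq_mul]
  refine Finset.sum_le_card_nsmul _ _ _ fun g _ => ?_
  have hz' := act_mem (sg_sq g) hz
  have h2 := hodd g z hz
  have h3 : f z = (∏ i, sg g i ^ α i) * f (act (sg g) z) := by
    rw [h2, ← mul_assoc, ← pow_two, ← sq_abs, habs]; ring
  rw [h3, ← mul_sub, abs_mul, habs, one_mul]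
  exact (hp _ hz').le

theorem cont_BU {J : Type} [Fintype J] [DecidableEq J] (α : J → ι → ℕ)
    (hJ : Fintype.card J = ∑ i, n i)
    (hco : coeff (fs n) (∏ j, ∑ i, C (α j i : ZMod 2) * X i : MvPolynomial ι (ZMod 2)) = 1)
    (f : J → (Vr n → ℝ) → ℝ) (hf : ∀ j, ContinuousOn (f j) (Xs n))
    (hodd : ∀ j, ∀ g : ι → ℤˣ, ∀ z ∈ Xs n, f j (act (sg g) z) = (∏ i, sg g i ^ α j i) * f j z) :
    ∃ z ∈ Xs n, ∀ j, f j z = 0 := by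
  have happ : ∀ ε : ℝ, 0 < ε → ∃ z ∈ Xs n, ∀ j, |f j z| ≤ ε := by
    intro ε hε
    choose N q hq hqz using fun j => approx (α j) (f j) (hf j) (hodd j) (half_pos hε)
    obtain ⟨z, hz, hzj⟩ := poly_BU (fun j i => α j i + 2 * N j) hJ (by
      rw [← hco]
      congr 1
      refine Finset.prod_congr rfl fun j _ => Finset.sum_congr rfl fun i _ => ?_
      congr 2
      push_cast
      have : (2 : ZMod 2) = 0 := rfl
      rw [this]; ring) q hq (half_pos hε)
    refine ⟨z, hz, fun j => ?_⟩
    have h1 := hzj j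
    have h2 := hqz j z hz
    rw [abs_le] at *
    constructor <;> linarith
  obtain ⟨z0, hz0, -⟩ := happ 1 one_pos
  have hcont : ContinuousOn (fun z => ∑ j, |f j z|) (Xs n) :=
    continuousOn_finsetSum _ fun j _ => (hf j).abs
  obtain ⟨z, hz, hmin⟩ := isCompact_Xs.exists_isMinOn ⟨z0, hz0⟩ hcont
  refine ⟨z, hz, ?_⟩
  by_contra hne
  push Not at hne
  obtain ⟨j0, hj0⟩ := hne
  have hm : 0 < ∑ j, |f j z| :=
    Finset.sum_pos' (fun _ _ => abs_nonneg _) ⟨j0, Finset.mem_univ _, abs_pos.2 hj0⟩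
  set m := ∑ j, |f j z|
  obtain ⟨w, hw, hwj⟩ := happ (m / (Fintype.card J + 1)) (by positivity)
  have h1 : m ≤ ∑ j, |f j w| := hmin hw
  have h2 : ∑ j, |f j w| ≤ Fintype.card J • (m / (Fintype.card J + 1)) :=
    Finset.sum_le_card_nsmul _ _ _ fun j _ => hwj j
  rw [nsmul_eq_mul] at h2
  have h3 : (Fintype.card J : ℝ) * (m / (Fintype.card J + 1)) < m := by
    rw [mul_div_assoc', div_lt_iff₀ (by positivity)]
    nlinarith
  linarith

end BU

namespace BU
open MvPolynomial

/-- Exponent vector. -/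
def vec (a b c d : ℕ) : Fin 4 →₀ ℕ := fs ![a, b, c, d]

/-- Number of ways of writing an exponent as a sum of exponents from the factors. -/
def cnt : List (List (ℕ × ℕ × ℕ × ℕ)) → ℕ → ℕ → ℕ → ℕ → ℕ
  | [], a, b, c, d => if a = 0 ∧ b = 0 ∧ c = 0 ∧ d = 0 then 1 else 0
  | l :: ls, a, b, c, d =>
    (l.map fun e => if e.1 ≤ a ∧ e.2.1 ≤ b ∧ e.2.2.1 ≤ c ∧ e.2.2.2 ≤ d then
      cnt ls (a - e.1) (b - e.2.1) (c - e.2.2.1) (d - e.2.2.2) else 0).sum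

/-- Polynomial of a factor. -/
def Pl (l : List (ℕ × ℕ × ℕ × ℕ)) : MvPolynomial (Fin 4) (ZMod 2) :=
  (l.map fun e => monomial (vec e.1 e.2.1 e.2.2.1 e.2.2.2) 1).sum

lemma vec_le (a b c d a' b' c' d' : ℕ) : vec a b c d ≤ vec a' b' c' d' ↔
    a ≤ a' ∧ b ≤ b' ∧ c ≤ c' ∧ d ≤ d' := by
  rw [Finsupp.le_def]
  simp [vec, fs, Fin.forall_fin_succ]

lemma vec_sub (a b c d a' b' c' d' : ℕ) : vec a b c d - vec a' b' c' d' =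
    vec (a - a') (b - b') (c - c') (d - d') := by
  ext i
  fin_cases i <;> simp [vec, fs]

lemma vec_zero (a b c d : ℕ) : 0 = vec a b c d ↔ a = 0 ∧ b = 0 ∧ c = 0 ∧ d = 0 := by
  rw [Finsupp.ext_iff]
  simp [vec, fs, Fin.forall_fin_succ, eq_comm]

lemma coeff_cnt (ls : List (List (ℕ × ℕ × ℕ × ℕ))) : ∀ a b c d : ℕ,
    coeff (vec a b c d) (ls.map Pl).prod = (cnt ls a b c d : ZMod 2) := by
  induction ls with
  | nil =>
    intro a b c d
    simp only [List.map_nil, List.prod_nil, cnt, coeff_one, vec_zero]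
    split_ifs <;> simp
  | cons l ls ih =>
    intro a b c d
    rw [List.map_cons, List.prod_cons, cnt, Pl]
    induction l with
    | nil => simp
    | cons e l ihl =>
      rw [List.map_cons, List.sum_cons, add_mul, coeff_add, ihl, List.map_cons, List.sum_cons,
        Nat.cast_add, coeff_monomial_mul']
      congr 1
      simp only [vec_le, vec_sub, ih, one_mul]
      split_ifs <;> simp

/-- The factors. -/
def facs : List (List (ℕ × ℕ × ℕ × ℕ)) :=
  [[(1,0,0,0)], [(0,1,0,0)], [(0,0,1,0)], [(0,0,0,1)],
   [(2,0,0,0), (0,2,0,0)], [(2,0,0,0), (0,0,2,0)], [(2,0,0,0), (0,0,0,2)],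
   [(0,2,0,0), (0,0,2,0)], [(0,2,0,0), (0,0,0,2)], [(0,0,2,0), (0,0,0,2)],
   [(0,1,0,0), (0,0,1,0), (0,0,0,1)], [(1,0,0,0), (0,0,1,0), (0,0,0,1)],
   [(1,0,0,0), (0,1,0,0), (0,0,0,1)], [(1,0,0,0), (0,1,0,0), (0,0,1,0)]]

lemma cnt_facs : (cnt facs 7 6 4 3) % 2 = 1 := by
  decide +kernel

/-- Dimensions of the spheres. -/
def nn : Fin 4 → ℕ := ![7, 6, 4, 3]

/-- The pairs. -/
def pr : Fin 6 → Fin 4 × Fin 4 := ![(0,1), (0,2), (0,3), (1,2), (1,3), (2,3)]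

/-- The index set of the constraints. -/
abbrev JJ := (Fin 4 ⊕ Fin 6) ⊕ (Fin 6 ⊕ Fin 4)

/-- The sets. -/
def AA : JJ → Finset (Fin 4)
  | .inl (.inl i) => {i}
  | .inl (.inr p) => {(pr p).1, (pr p).2}
  | .inr (.inl p) => {(pr p).1, (pr p).2}
  | .inr (.inr k) => {k}ᶜ

/-- The parities. -/
def al (j : JJ) (i : Fin 4) : ℕ := if i ∈ AA j then 1 else 0

lemma mon (a b c d : ℕ) : (monomial (vec a b c d) 1 : MvPolynomial (Fin 4) (ZMod 2)) =
    X 0 ^ a * X 1 ^ b * X 2 ^ c * X 3 ^ d := by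
  rw [monomial_eq, Finsupp.prod_fintype _ _ (by simp), Fin.prod_univ_four]
  simp [vec, fs]

lemma sq2 (x y : MvPolynomial (Fin 4) (ZMod 2)) : (x + y) * (x + y) = x ^ 2 + y ^ 2 := by
  have : (2 : MvPolynomial (Fin 4) (ZMod 2)) = 0 := CharTwo.two_eq_zero
  linear_combination (x * y) * this

lemma al_prod : (∏ j, ∑ i, C (al j i : ZMod 2) * X i : MvPolynomial (Fin 4) (ZMod 2)) =
    (facs.map Pl).prod := by
  have h1 : ∀ p : Fin 6, (∑ i, C (al (.inr (.inl p)) i : ZMod 2) * X i : MvPolynomial (Fin 4) (ZMod 2)) =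
    ∑ i, C (al (.inl (.inr p)) i : ZMod 2) * X i := fun p => rfl
  have h2 : ∀ p : Fin 6, (∑ i, C (al (.inl (.inr p)) i : ZMod 2) * X i : MvPolynomial (Fin 4) (ZMod 2)) =
     X (pr p).1 + X (pr p).2 := by
    intro p
    fin_cases p <;> simp [Fin.sum_univ_four, al, AA, pr]
  have h3 : ∀ p : Fin 4, (∑ i, C (al (.inl (.inl p)) i : ZMod 2) * X i : MvPolynomial (Fin 4) (ZMod 2)) =
     X p := by
    intro p
    fin_cases p <;> simp [Fin.sum_univ_four, al, AA]
  have h4 : ∀ p : Fin 4, (∑ i, C (al (.inr (.inr p)) i : ZMod 2) * X i : MvPolynomial (Fin 4) (ZMod 2)) =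
     ![X 1 + X 2 + X 3, X 0 + X 2 + X 3, X 0 + X 1 + X 3, X 0 + X 1 + X 2] p := by
    intro p
    fin_cases p <;> simp [Fin.sum_univ_four, al, AA]
  rw [Fintype.prod_sum_type, Fintype.prod_sum_type, Fintype.prod_sum_type]
  simp_rw [h1, h2, h3, h4]
  have h5 : ∀ a b c d : MvPolynomial (Fin 4) (ZMod 2), (a * b) * (c * d) = a * ((b * c) * d) := by
    intros; ring
  rw [h5, ← Finset.prod_mul_distrib]
  simp_rw [sq2]
  simp only [facs, List.map_cons, List.map_nil, List.prod_cons, List.prod_nil, Pl, mon, List.sum_cons,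
    List.sum_nil, pow_zero, pow_one, one_mul, mul_one, add_zero, Fin.prod_univ_four, Fin.prod_univ_six, pr]
  simp [Fin.prod_univ_four]
  simp only [mul_assoc, add_assoc]

lemma al_coeff : coeff (fs nn) (∏ j, ∑ i, C (al j i : ZMod 2) * X i : MvPolynomial (Fin 4) (ZMod 2)) = 1 := by
  rw [al_prod]
  have h := coeff_cnt facs 7 6 4 3
  have h2 : (cnt facs 7 6 4 3 : ZMod 2) = 1 :=
    ZMod.natCast_eq_one_iff_odd.2 (Nat.odd_iff.2 cnt_facs)
  rw [h2] at h
  exact h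

lemma card_JJ : Fintype.card JJ = ∑ i, nn i := by decide

lemma cover (A : Finset (Fin 4)) (h : A.Nonempty) (h3 : A.card ≤ 3) :
    ∃ j : JJ, AA j = A ∧ ∀ p, j ≠ .inr (.inl p) := by
  revert A; decide

lemma cover2 (i j : Fin 4) (h : i ≠ j) : ∃ p, pr p = (i, j) ∨ pr p = (j, i) := by
  revert i j; decide

lemma pr_ne (p : Fin 6) : (pr p).1 ≠ (pr p).2 := by
  revert p; decide

end BU

namespace BU
open MvPolynomial

/-- The ambient space. -/
abbrev E7 := EuclideanSpace ℝ (Fin 7)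

/-- Normal vectors. -/
def na (i : Fin 4) (z : Vr nn → ℝ) : E7 :=
  WithLp.toLp 2 fun k : Fin 7 => if h : k.val < nn i then z ⟨i, ⟨k.val, Nat.lt_succ_of_lt h⟩⟩ else 0

/-- Offsets. -/
def nb (i : Fin 4) (z : Vr nn → ℝ) : ℝ := z ⟨i, Fin.last _⟩

lemma na_cont (i : Fin 4) : Continuous (na i) := by
  refine (PiLp.continuous_toLp 2 _).comp (continuous_pi fun k => ?_)
  split_ifs
  · exact continuous_apply _
  · exact continuous_const

lemma nb_cont (i : Fin 4) : Continuous (nb i) := continuous_apply _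

lemma na_act (i : Fin 4) (g : Fin 4 → ℝ) (z : Vr nn → ℝ) : na i (act g z) = g i • na i z := by
  ext k
  simp only [na, act, PiLp.smul_apply, smul_eq_mul]
  split_ifs <;> simp

lemma nb_act (i : Fin 4) (g : Fin 4 → ℝ) (z : Vr nn → ℝ) : nb i (act g z) = g i * nb i z := rfl

lemma nn_le (i : Fin 4) : nn i ≤ 7 := by fin_cases i <;> simp [nn]

lemma nb_ne {i : Fin 4} {z : Vr nn → ℝ} (hz : z ∈ Xs nn) (h : na i z = 0) : nb i z ≠ 0 := by
  intro hb
  have h1 := hz i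
  rw [Fin.sum_univ_castSucc] at h1
  have h2 : z ⟨i, Fin.last _⟩ = 0 := hb
  have h3 : ∀ j : Fin (nn i), z ⟨i, j.castSucc⟩ = 0 := by
    intro j
    have h4 := congrArg (fun v : E7 => v ⟨j.val, j.2.trans_le (nn_le i)⟩) h
    simp only [na, PiLp.zero_apply] at h4
    rw [dif_pos j.2] at h4
    exact h4
  simp [h2, h3] at h1

/-- The affine functional. -/
def LL (i : Fin 4) (z : Vr nn → ℝ) (x : E7) : ℝ := ⟪na i z, x⟫ - nb i z

lemma LL_cont (i : Fin 4) (x : E7) : Continuous fun z => LL i z x :=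
  ((na_cont i).inner continuous_const).sub (nb_cont i)

lemma LL_cont' (i : Fin 4) (z : Vr nn → ℝ) : Continuous (LL i z) :=
  (continuous_const.inner continuous_id).sub continuous_const

lemma LL_act (i : Fin 4) (g : Fin 4 → ℝ) (z : Vr nn → ℝ) (x : E7) :
    LL i (act g z) x = g i * LL i z x := by
  rw [LL, na_act, nb_act, real_inner_smul_left, LL]; ring

lemma hyper_null (a : E7) (b : ℝ) (ha : a ≠ 0) : (volume : Measure E7) {x | ⟪a, x⟫ - b = 0} = 0 := by
  have hn : ⟪a, a⟫ ≠ (0 : ℝ) := inner_self_ne_zero.2 ha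
  have h1 : (volume : Measure E7) ((LinearMap.ker (innerₛₗ ℝ a) : Submodule ℝ E7) : Set E7) = 0 := by
    refine Measure.addHaar_submodule _ _ ?_
    intro h
    have : a ∈ LinearMap.ker (innerₛₗ ℝ a) := by rw [h]; trivial
    rw [LinearMap.mem_ker] at this
    exact hn this
  have h2 := measure_preimage_add_right (volume : Measure E7) (-((b / ⟪a, a⟫) • a))
    ((LinearMap.ker (innerₛₗ ℝ a) : Submodule ℝ E7) : Set E7)
  rw [h1] at h2
  rw [← h2]
  congr 1
  ext x
  simp only [Set.mem_ofPred_eq, Set.mem_preimage, SetLike.mem_coe, LinearMap.mem_ker]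
  change _ ↔ ⟪a, x + -((b / ⟪a, a⟫) • a)⟫ = (0 : ℝ)
  rw [inner_add_right, inner_neg_right, real_inner_smul_right, div_mul_cancel₀ _ hn, sub_eq_add_neg]

lemma sign_contAt {r : ℝ} (hr : r ≠ 0) : ContinuousAt Real.sign r := by
  rcases lt_or_gt_of_ne hr with h | h
  · refine (continuousAt_const (y := (-1 : ℝ))).congr ?_
    filter_upwards [gt_mem_nhds h] with x hx
    exact (Real.sign_of_neg hx).symm
  · refine (continuousAt_const (y := (1 : ℝ))).congr ?_
    filter_upwards [lt_mem_nhds h] with x hx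
    exact (Real.sign_of_pos hx).symm

lemma sign_meas : Measurable Real.sign := by
  unfold Real.sign
  exact Measurable.ite measurableSet_Iio measurable_const
    (Measurable.ite measurableSet_Ioi measurable_const measurable_const)

lemma sign_abs (r : ℝ) : |Real.sign r| ≤ 1 := by
  rcases Real.sign_apply_eq r with h | h | h <;> simp [h]

variable (μ : Measure E7) [IsFiniteMeasure μ]

/-- Product of signs. -/
def PS (A : Finset (Fin 4)) (z : Vr nn → ℝ) (x : E7) : ℝ := ∏ i ∈ A, Real.sign (LL i z x)

/-- The test functions. -/
def SS (A : Finset (Fin 4)) (z : Vr nn → ℝ) : ℝ := ∫ x, PS A z x ∂μ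

lemma PS_meas (A : Finset (Fin 4)) (z : Vr nn → ℝ) : Measurable (PS A z) :=
  Finset.measurable_fun_prod _ fun i _ => sign_meas.comp (LL_cont' i z).measurable

lemma PS_bd (A : Finset (Fin 4)) (z : Vr nn → ℝ) (x : E7) : ‖PS A z x‖ ≤ 1 := by
  rw [PS, Real.norm_eq_abs, Finset.abs_prod]
  exact Finset.prod_le_one (fun _ _ => abs_nonneg _) fun _ _ => sign_abs _

lemma PS_int (A : Finset (Fin 4)) (z : Vr nn → ℝ) : Integrable (PS A z) μ :=
  Integrable.of_bound (PS_meas A z).aestronglyMeasurable 1 (Filter.Eventually.of_forall (PS_bd A z))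

lemma ae_ne (hac : μ ≪ volume) {z : Vr nn → ℝ} (hz : z ∈ Xs nn) (i : Fin 4) : ∀ᵐ x ∂μ, LL i z x ≠ 0 := by
  by_cases h : na i z = 0
  · refine Filter.Eventually.of_forall fun x => ?_
    rw [LL, h, inner_zero_left, zero_sub]
    exact neg_ne_zero.2 (nb_ne hz h)
  · rw [ae_iff]
    simp only [ne_eq, not_not]
    exact hac (hyper_null _ _ h)

lemma SS_cont (hac : μ ≪ volume) (A : Finset (Fin 4)) : ContinuousOn (SS μ A) (Xs nn) := by
  intro z hz
  refine ContinuousAt.continuousWithinAt ?_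
  refine continuousAt_of_dominated (bound := fun _ => 1)
    (Filter.Eventually.of_forall fun w => (PS_meas A w).aestronglyMeasurable)
    (Filter.Eventually.of_forall fun w => Filter.Eventually.of_forall (PS_bd A w))
    (integrable_const 1) ?_
  have : ∀ᵐ x ∂μ, ∀ i, LL i z x ≠ 0 := ae_all_iff.2 fun i => ae_ne μ hac hz i
  filter_upwards [this] with x hx
  refine tendsto_finsetProd _ fun i _ => ?_
  exact ContinuousAt.comp (f := fun z => LL i z x) (sign_contAt (hx i)) (LL_cont i x).continuousAt

lemma sg_cases (g : Fin 4 → ℤˣ) (i : Fin 4) : sg g i = 1 ∨ sg g i = -1 := by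
  rcases Int.units_eq_one_or (g i) with h | h <;> simp [sg, h]

lemma ind_prod (A : Finset (Fin 4)) (g : Fin 4 → ℝ) :
    ∏ i, g i ^ (if i ∈ A then 1 else 0) = ∏ i ∈ A, g i := by
  rw [← Finset.prod_subset (Finset.subset_univ A)]
  · refine Finset.prod_congr rfl fun i hi => ?_
    rw [if_pos hi, pow_one]
  · intro i _ hi
    rw [if_neg hi, pow_zero]

lemma SS_odd (A : Finset (Fin 4)) (g : Fin 4 → ℤˣ) (z : Vr nn → ℝ) :
    SS μ A (act (sg g) z) = (∏ i, sg g i ^ (if i ∈ A then 1 else 0)) * SS μ A z := by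
  rw [ind_prod, SS, SS, ← integral_const_mul]
  congr 1
  funext x
  rw [PS, PS, ← Finset.prod_mul_distrib]
  refine Finset.prod_congr rfl fun i _ => ?_
  rw [LL_act]
  rcases sg_cases g i with h | h
  · rw [h, one_mul, one_mul]
  · rw [h, neg_one_mul, Real.sign_neg, neg_one_mul]

/-- All test functions. -/
def ff : JJ → (Vr nn → ℝ) → ℝ
  | .inr (.inl p) => fun z => ⟪na (pr p).1 z, na (pr p).2 z⟫
  | .inl j => SS μ (AA (.inl j))
  | .inr (.inr k) => SS μ (AA (.inr (.inr k)))

lemma ff_cont (hac : μ ≪ volume) (j : JJ) : ContinuousOn (ff μ j) (Xs nn) := by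
  rcases j with j | j | j
  · exact SS_cont μ hac _
  · exact ((na_cont _).inner (na_cont _)).continuousOn
  · exact SS_cont μ hac _

lemma ff_odd (j : JJ) (g : Fin 4 → ℤˣ) (z : Vr nn → ℝ) :
    ff μ j (act (sg g) z) = (∏ i, sg g i ^ al j i) * ff μ j z := by
  rcases j with j | j | j
  · exact SS_odd μ _ g z
  · have h := ind_prod (AA (.inr (.inl j))) (sg g)
    change ∏ i, sg g i ^ al (.inr (.inl j)) i = _ at h
    rw [h]
    simp only [ff, AA]
    rw [Finset.prod_pair (pr_ne j), na_act, na_act, real_inner_smul_left, real_inner_smul_right, mul_assoc]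
  · exact SS_odd μ _ g z

lemma exists_z (hac : μ ≪ volume) : ∃ z ∈ Xs nn,
    (∀ A : Finset (Fin 4), A.Nonempty → A.card ≤ 3 → SS μ A z = 0) ∧
    ∀ i j, i ≠ j → ⟪na i z, na j z⟫ = (0 : ℝ) := by
  obtain ⟨z, hz, h⟩ := cont_BU al card_JJ al_coeff (ff μ) (ff_cont μ hac) (fun j g z _ => ff_odd μ j g z)
  refine ⟨z, hz, fun A hA h3 => ?_, fun i j hij => ?_⟩
  · obtain ⟨j, rfl, hj⟩ := cover A hA h3
    have := h j
    rcases j with j | j | j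
    · exact this
    · exact absurd rfl (hj j)
    · exact this
  · obtain ⟨p, hp⟩ := cover2 i j hij
    have h1 : ⟪na (pr p).1 z, na (pr p).2 z⟫ = (0 : ℝ) := h (.inr (.inl p))
    rcases hp with hp | hp
    · rw [hp] at h1; exact h1
    · rw [hp, real_inner_comm] at h1; exact h1

lemma reg_meas (a : Fin 4 → E7) (b : Fin 4 → ℝ) (s : Finset (Fin 4)) (ε : Fin 4 → Bool) :
    MeasurableSet (region a b s ε) := by
  unfold region
  refine Finset.measurableSet_biInter _ fun i _ => ?_
  unfold halfSpace
  have hc : Continuous fun x : E7 => ⟪a i, x⟫ := continuous_const.inner continuous_id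
  split_ifs
  · exact measurableSet_le measurable_const hc.measurable
  · exact measurableSet_le hc.measurable measurable_const

lemma reg_real (hac : μ ≪ volume) {z : Vr nn → ℝ} (hz : z ∈ Xs nn)
    (hS : ∀ A : Finset (Fin 4), A.Nonempty → A.card ≤ 3 → SS μ A z = 0)
    (s : Finset (Fin 4)) (hs : s.card = 3) (ε : Fin 4 → Bool) :
    μ.real (region (fun i => na i z) (fun i => nb i z) s ε) = μ.real Set.univ / 8 := by
  classical
  set R := region (fun i => na i z) (fun i => nb i z) s ε with hR
  let e : Fin 4 → ℝ := fun i => if ε i then 1 else -1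
  have hall : ∀ᵐ x ∂μ, ∀ i, LL i z x ≠ 0 := ae_all_iff.2 fun i => ae_ne μ hac hz i
  have h1 : ∀ᵐ x ∂μ, R.indicator (fun _ => (1 : ℝ)) x =
      ∑ A ∈ s.powerset, (1 / 8 * ∏ i ∈ A, e i) * PS A z x := by
    filter_upwards [hall] with x hx
    have h2 : R.indicator (fun _ => (1 : ℝ)) x = ∏ i ∈ s, ((1 + e i * Real.sign (LL i z x)) / 2) := by
      have key : ∀ i, (1 + e i * Real.sign (LL i z x)) / 2 =
          if x ∈ halfSpace (na i z) (nb i z) (ε i) then 1 else 0 := by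
        intro i
        have hL : LL i z x = ⟪na i z, x⟫ - nb i z := rfl
        rcases lt_or_gt_of_ne (hx i) with h | h
        · rw [Real.sign_of_neg h]
          rw [hL] at h
          by_cases hε : ε i = true
          · rw [if_neg]
            · simp [e, hε]
            · simp only [halfSpace, hε, if_true, Set.mem_ofPred_eq]; linarith
          · rw [if_pos]
            · simp [e, hε]
            · simp only [halfSpace, hε, Set.mem_ofPred_eq]; simp; linarith
        · rw [Real.sign_of_pos h]
          rw [hL] at h
          by_cases hε : ε i = true
          · rw [if_pos]
            · simp [e, hε]
            · simp only [halfSpace, hε, if_true, Set.mem_ofPred_eq]; linarith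
          · rw [if_neg]
            · simp [e, hε]
            · simp only [halfSpace, hε, Set.mem_ofPred_eq]; simp; linarith
      simp_rw [key]
      by_cases hxR : x ∈ R
      · rw [Set.indicator_of_mem hxR, Finset.prod_eq_one]
        intro i hi
        rw [if_pos]
        exact Set.mem_iInter₂.1 hxR i hi
      · rw [Set.indicator_of_notMem hxR]
        have : ∃ i ∈ s, x ∉ halfSpace (na i z) (nb i z) (ε i) := by
          by_contra hcon
          push Not at hcon
          exact hxR (Set.mem_iInter₂.2 hcon)
        obtain ⟨i, hi, hxi⟩ := this
        rw [Finset.prod_eq_zero hi]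
        rw [if_neg hxi]
    rw [h2, Finset.prod_div_distrib, Finset.prod_const, hs, Finset.prod_one_add, Finset.sum_div]
    refine Finset.sum_congr rfl fun A _ => ?_
    rw [Finset.prod_mul_distrib, PS]; ring
  have h3 : ∫ x, R.indicator (fun _ => (1 : ℝ)) x ∂μ = μ.real R := by
    rw [integral_indicator (reg_meas _ _ _ _)]; simp [hR]
  rw [← h3, integral_congr_ae h1, integral_finsetSum _ fun A _ => (PS_int μ A z).const_mul _,
    Finset.sum_eq_single ∅]
  · rw [integral_const_mul]; simp [PS]; ring
  · intro A hA hne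
    rw [integral_const_mul]
    have := hS A (Finset.nonempty_iff_ne_empty.2 hne) (hs ▸ Finset.card_le_card (Finset.mem_powerset.1 hA))
    rw [SS] at this
    rw [this, mul_zero]
  · intro h; exact absurd (Finset.empty_mem_powerset s) h

lemma na_ne (hμ : μ ≠ 0) {z : Vr nn → ℝ} (hz : z ∈ Xs nn) (i : Fin 4) (hS : SS μ {i} z = 0) :
    na i z ≠ 0 := by
  intro h
  have h1 : ∀ x, PS {i} z x = Real.sign (-nb i z) := by
    intro x
    rw [PS, Finset.prod_singleton, LL, h, inner_zero_left, zero_sub]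
  rw [SS] at hS
  simp_rw [h1] at hS
  rw [integral_const, smul_eq_mul, mul_eq_zero] at hS
  rcases hS with h2 | h2
  · rw [measureReal_eq_zero_iff, Measure.measure_univ_eq_zero] at h2
    exact hμ h2
  · rw [Real.sign_eq_zero_iff, neg_eq_zero] at h2
    exact nb_ne hz h h2

end BU

theorem stmt_19 (μ : Measure (EuclideanSpace ℝ (Fin 7)))
    (hfin : IsFiniteMeasure μ) (hac : μ ≪ volume) :
    ∃ (a : Fin 4 → EuclideanSpace ℝ (Fin 7)) (b : Fin 4 → ℝ),
      (∀ i, a i ≠ 0) ∧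
      (∀ i j, i ≠ j → ⟪a i, a j⟫ = (0 : ℝ)) ∧
      ∀ s : Finset (Fin 4), s.card = 3 → ∀ ε : Fin 4 → Bool,
        μ (region a b s ε) = μ Set.univ / 2 ^ 3 := by
  by_cases hμ : μ = 0
  · refine ⟨fun i => EuclideanSpace.single (Fin.castLE (by norm_num) i) 1, 0, fun i => ?_, ?_, ?_⟩
    · simp
    · intro i j hij
      simp [EuclideanSpace.inner_single_left, hij]
    · intro s _ ε
      simp [hμ]
  · obtain ⟨z, hz, hS, ho⟩ := BU.exists_z μ hac
    refine ⟨fun i => BU.na i z, fun i => BU.nb i z, fun i => ?_, ho, fun s hs ε => ?_⟩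
    · exact BU.na_ne μ hμ hz i (hS {i} (Finset.singleton_nonempty i) (by simp))
    · have h := BU.reg_real μ hac hz hS s hs ε
      rw [← ENNReal.toReal_eq_toReal_iff' (measure_ne_top μ _)
        (ENNReal.div_ne_top (measure_ne_top μ _) (by norm_num)), ENNReal.toReal_div]
      simp only [measureReal_def] at h
      rw [h]
      norm_num
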